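/- arXiv:0906.4579 — 3 statements merged into one kernel-verified Lean document; each statement's English description precedes it below -/
import Mathlib

section
/- For every n ≥ 1 there exists a neighborhood U of the identity matrix in GL_n(ℂ) such that the only subgroup of GL_n(ℂ) entirely contained in U is the trivial subgroup {Id}. -/
/-- The unit group of a real normed algebra has no small subgroups. The key identity is
`2 * (h - 1) = (h ^ 2 - 1) - (h - 1) ^ 2`, which shows that a uniform bound `‖h - 1‖ ≤ 1 / 2`
over a subgroup improves to arbitrarily small bounds. -/
theorem Units.exists_nhds_one_subgroup_eq_bot (A : Type*) [NormedRing A] [NormedAlgebra ℝ A] :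
    ∃ U ∈ nhds (1 : Aˣ), ∀ H : Subgroup Aˣ, (H : Set Aˣ) ⊆ U → H = ⊥ := by
  refine ⟨Units.val ⁻¹' Metric.closedBall (1 : A) (1 / 2),
    Units.continuous_val.continuousAt.preimage_mem_nhds
      (by simpa using Metric.closedBall_mem_nhds (1 : A) (by norm_num : (0 : ℝ) < 1 / 2)),
    fun H hH => ?_⟩
  have half_bound : ∀ h ∈ H, ‖(h : A) - 1‖ ≤ 1 / 2 := fun h hh => by
    simpa [dist_eq_norm] using hH hh
  have pow_bound : ∀ k : ℕ, ∀ h ∈ H, ‖(h : A) - 1‖ ≤ (3 / 4 : ℝ) ^ k := by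
    intro k
    induction k with
    | zero => exact fun h hh => (half_bound h hh).trans (by norm_num)
    | succ k ih =>
      intro h hh
      have key : (2 : ℝ) • ((h : A) - 1) =
          (((h * h : Aˣ) : A) - 1) - ((h : A) - 1) * ((h : A) - 1) := by
        rw [two_smul, Units.val_mul]
        noncomm_ring
      have hnorm : 2 * ‖(h : A) - 1‖ ≤
          ‖((h * h : Aˣ) : A) - 1‖ + ‖(h : A) - 1‖ * ‖(h : A) - 1‖ := by
        calc 2 * ‖(h : A) - 1‖ = ‖(2 : ℝ) • ((h : A) - 1)‖ := by rw [norm_smul]; norm_num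
          _ ≤ _ := by
            rw [key]
            exact (norm_sub_le _ _).trans (by gcongr; exact norm_mul_le _ _)
      have hsq := ih _ (H.mul_mem hh hh)
      rw [pow_succ]
      nlinarith [half_bound h hh, ih h hh, norm_nonneg ((h : A) - 1)]
  refine (Subgroup.eq_bot_iff_forall H).2 fun h hh => Units.ext ?_
  have hle : ‖(h : A) - 1‖ ≤ 0 :=
    ge_of_tendsto' (tendsto_pow_atTop_nhds_zero_of_lt_one (by norm_num) (by norm_num))
      fun k => pow_bound k h hh
  exact sub_eq_zero.1 (norm_le_zero_iff.1 hle)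

/-- `GL n ℂ` has no small subgroups: there is a neighborhood of the identity containing
no nontrivial subgroup. -/
theorem stmt_2 (n : ℕ) (hn : 1 ≤ n) :
    ∃ U ∈ nhds (1 : GL (Fin n) ℂ),
      ∀ H : Subgroup (GL (Fin n) ℂ), (H : Set (GL (Fin n) ℂ)) ⊆ U → H = ⊥ := by
  let _ : NormedRing (Matrix (Fin n) (Fin n) ℂ) := Matrix.linftyOpNormedRing
  let _ : NormedAlgebra ℝ (Matrix (Fin n) (Fin n) ℂ) := Matrix.linftyOpNormedAlgebra
  exact Units.exists_nhds_one_subgroup_eq_bot (Matrix (Fin n) (Fin n) ℂ)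
end

section
/- Let G be a group, k a finite field, and let (ρ, V) and (ρ′, V′) be two finite-dimensional semisimple representations of G over k. If the characteristic polynomials agree, i.e. det(Id − X ρ(g)) = det(Id − X ρ′(g)) in k[X] for every g ∈ G, then ρ and ρ′ are isomorphic as representations of G. -/
open Polynomial

section LSMul

variable {k A M N : Type*} [Field k] [Ring A] [Algebra k A]
  [AddCommGroup M] [Module k M] [Module A M] [IsScalarTower k A M]
  [AddCommGroup N] [Module k N] [Module A N] [IsScalarTower k A N]

theorem LinearEquiv.conj_lsmul (e : M ≃ₗ[A] N) (a : A) :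
    (e.restrictScalars k).conj (Algebra.lsmul k k M a) = Algebra.lsmul k k N a := by
  ext x
  simp [LinearEquiv.conj_apply]

theorem LinearMap.prodMap_lsmul (a : A) :
    (Algebra.lsmul k k M a).prodMap (Algebra.lsmul k k N a) = Algebra.lsmul k k (M × N) a := by
  ext x <;> simp

theorem LinearEquiv.trace_lsmul_eq (e : M ≃ₗ[A] N) (a : A) :
    LinearMap.trace k M (Algebra.lsmul k k M a) = LinearMap.trace k N (Algebra.lsmul k k N a) := by
  rw [← e.conj_lsmul, LinearMap.trace_conj']

variable [FiniteDimensional k M] [FiniteDimensional k N]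

theorem LinearEquiv.charpoly_lsmul_eq (e : M ≃ₗ[A] N) (a : A) :
    (Algebra.lsmul k k M a).charpoly = (Algebra.lsmul k k N a).charpoly := by
  rw [← e.conj_lsmul, LinearEquiv.charpoly_conj]

theorem LinearMap.charpoly_lsmul_prod (a : A) :
    (Algebra.lsmul k k (M × N) a).charpoly =
      (Algebra.lsmul k k M a).charpoly * (Algebra.lsmul k k N a).charpoly := by
  rw [← LinearMap.prodMap_lsmul, LinearMap.charpoly_prodMap]

theorem LinearMap.trace_lsmul_prod (a : A) :
    LinearMap.trace k (M × N) (Algebra.lsmul k k (M × N) a) =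
      LinearMap.trace k M (Algebra.lsmul k k M a) +
        LinearMap.trace k N (Algebra.lsmul k k N a) := by
  rw [← LinearMap.prodMap_lsmul, LinearMap.trace_prodMap']

variable (M) in
theorem LinearMap.charpoly_lsmul_fin_fun (n : ℕ) (a : A) :
    (Algebra.lsmul k k (Fin n → M) a).charpoly = (Algebra.lsmul k k M a).charpoly ^ n := by
  induction n with
  | zero =>
    rw [pow_zero]
    exact (LinearMap.charpoly_monic _).natDegree_eq_zero.mp <|
      (LinearMap.charpoly_natDegree _).trans Module.finrank_zero_of_subsingleton
  | succ n ih =>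
    rw [pow_succ', ← ih, ← LinearMap.charpoly_lsmul_prod,
      (Fin.consLinearEquiv A fun _ : Fin (n + 1) ↦ M).charpoly_lsmul_eq]

variable (M) in
theorem LinearMap.trace_lsmul_fin_fun (n : ℕ) (a : A) :
    LinearMap.trace k (Fin n → M) (Algebra.lsmul k k (Fin n → M) a) =
      n * LinearMap.trace k M (Algebra.lsmul k k M a) := by
  induction n with
  | zero => rw [Subsingleton.elim (Algebra.lsmul k k (Fin 0 → M) a) 0]; simp
  | succ n ih =>
    rw [Nat.cast_succ, add_one_mul, ← ih, add_comm (LinearMap.trace k (Fin n → M) _), ← LinearMap.trace_lsmul_prod,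
      (Fin.consLinearEquiv A fun _ : Fin (n + 1) ↦ M).trace_lsmul_eq]

end LSMul

theorem LinearMap.trace_eq_neg_charpoly_nextCoeff {k M : Type*} [Field k] [AddCommGroup M]
    [Module k M] [FiniteDimensional k M] (f : Module.End k M) :
    LinearMap.trace k M f = -f.charpoly.nextCoeff := by
  rw [LinearMap.trace_eq_matrix_trace k (Module.finBasis k M) f,
    Matrix.trace_eq_neg_charpoly_nextCoeff, LinearMap.charpoly_toMatrix]

theorem LinearMap.exists_isSimpleModule_linearEquiv_of_ne_zero {A M N : Type*} [Ring A]
    [AddCommGroup M] [Module A M] [AddCommGroup N] [Module A N] [IsSemisimpleModule A M]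
    {f : M →ₗ[A] N} (hf : f ≠ 0) :
    ∃ (S : Submodule A M) (S' : Submodule A N), IsSimpleModule A S ∧ Nonempty (S ≃ₗ[A] S') := by
  obtain ⟨S, hS, hne⟩ :=
    LinearMap.exists_ne_zero_of_sSup_eq_top hf _ (IsSemisimpleModule.sSup_simples_eq_top A M)
  have : IsSimpleModule A S := hS
  exact ⟨S, _, hS, ⟨LinearEquiv.ofInjective _ (LinearMap.injective_of_ne_zero hne)⟩⟩

instance IsSemisimpleModule.prod {A M N : Type*} [Ring A]
    [AddCommGroup M] [Module A M] [AddCommGroup N] [Module A N]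
    [IsSemisimpleModule A M] [IsSemisimpleModule A N] : IsSemisimpleModule A (M × N) := by
  have h := IsSemisimpleModule.sup (IsSemisimpleModule.range (LinearMap.inl A M N))
    (IsSemisimpleModule.range (LinearMap.inr A M N))
  rw [LinearMap.sup_range_inl_inr] at h
  exact .congr Submodule.topEquiv.symm

/-- Semisimple modules with no common constituent are separated by an element of the ring. -/
theorem IsSemisimpleModule.exists_smul_eq_self_and_smul_eq_zero {A M N : Type*} [Ring A]
    [AddCommGroup M] [Module A M] [AddCommGroup N] [Module A N] [Finite M] [Finite N]
    [IsSemisimpleModule A M] [IsSemisimpleModule A N]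
    (hMN : ∀ f : M →ₗ[A] N, f = 0) (hNM : ∀ f : N →ₗ[A] M, f = 0) :
    ∃ a : A, (∀ x : M, a • x = x) ∧ ∀ y : N, a • y = 0 := by
  let P : Module.End (Module.End A (M × N)) (M × N) :=
    { toFun := fun x ↦ (x.1, 0)
      map_add' := by simp
      map_smul' := by
        rintro φ ⟨x, y⟩
        have h₁ : (φ (x, 0)).2 = 0 :=
          congr($(hMN (LinearMap.snd A M N ∘ₗ φ ∘ₗ LinearMap.inl A M N)) x)
        have h₂ : (φ (0, y)).1 = 0 :=
          congr($(hNM (LinearMap.fst A M N ∘ₗ φ ∘ₗ LinearMap.inr A M N)) y)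
        have h : φ (x, y) = φ (x, 0) + φ (0, y) := by rw [← map_add]; simp
        ext <;> simp [h, h₁, h₂] }
  cases nonempty_fintype M
  cases nonempty_fintype N
  obtain ⟨a, ha⟩ := jacobson_density P Finset.univ
  refine ⟨a, fun x ↦ ?_, fun y ↦ ?_⟩
  · simpa [P] using congr(($(ha (x, 0) (Finset.mem_univ _))).1).symm
  · simpa [P] using congr(($(ha (0, y) (Finset.mem_univ _))).2).symm

theorem exists_trace_mulRight_ne_zero (k D : Type*) [Field k] [Finite k] [DivisionRing D]
    [Algebra k D] [FiniteDimensional k D] :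
    ∃ c : D, LinearMap.trace k D (LinearMap.mulRight k c) ≠ 0 := by
  have : Finite D := Module.finite_of_finite k
  let _ : Field D := littleWedderburn D
  by_contra! h
  refine Algebra.trace_ne_zero k D (LinearMap.ext fun c ↦ ?_)
  rw [Algebra.trace_apply, LinearMap.zero_apply, ← h c]
  congr 1
  ext x
  exact mul_comm c x

theorem IsSimpleModule.exists_trace_lsmul_ne_zero (k A S : Type*) [Field k] [Finite k] [Ring A]
    [Algebra k A] [AddCommGroup S] [Module k S] [Module A S] [IsScalarTower k A S]
    [FiniteDimensional k S] [IsSimpleModule A S] :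
    ∃ a : A, LinearMap.trace k S (Algebra.lsmul k k S a) ≠ 0 := by
  classical
  have : Finite S := Module.finite_of_finite k
  cases nonempty_fintype S
  have : Finite (Module.End A S) := .of_injective _ DFunLike.coe_injective
  have : Module.Finite k (Module.End A S) := .of_finite
  obtain ⟨c, hc⟩ := exists_trace_mulRight_ne_zero k (Module.End A S)
  have := IsSimpleModule.nontrivial A S
  obtain ⟨v, hv⟩ := exists_ne (0 : S)
  let ι := LinearMap.toSpanSingleton (Module.End A S) S v
  obtain ⟨φ, hφ⟩ := LinearMap.exists_leftInverse_of_injective ι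
    (LinearMap.ker_toSpanSingleton (Module.End A S) hv)
  let r := LinearMap.toSpanSingleton (Module.End A S) (Module.End A S) c
  obtain ⟨a, ha⟩ := jacobson_density (ι ∘ₗ r ∘ₗ φ) Finset.univ
  refine ⟨a, ?_⟩
  have h₁ : Algebra.lsmul k k S a = ι.restrictScalars k ∘ₗ (r ∘ₗ φ).restrictScalars k := by
    ext x
    exact (ha x (Finset.mem_univ _)).symm
  have h₂ : (r ∘ₗ φ).restrictScalars k ∘ₗ ι.restrictScalars k = LinearMap.mulRight k c := by
    ext1 x
    change r ((φ ∘ₗ ι) x) = x * c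
    rw [hφ]
    rfl
  rwa [h₁, LinearMap.trace_comp_comm', h₂]

section Pow

variable {k A : Type*} [Field k] [Finite k] [Ring A] [Algebra k A]

theorem Submodule.exists_linearEquiv_fun_of_linearEquiv {A M W ι : Type*} [Ring A]
    [AddCommGroup M] [Module A M] [AddCommGroup W] [Module A W] [Nonempty ι]
    (e : M ≃ₗ[A] (ι → W)) : ∃ U : Submodule A M, Nonempty (M ≃ₗ[A] (ι → U)) := by
  classical
  obtain ⟨i⟩ := ‹Nonempty ι›
  let f : W →ₗ[A] M := e.symm ∘ₗ LinearMap.single A (fun _ : ι ↦ W) i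
  have hf : Function.Injective f := e.symm.injective.comp (Pi.single_injective (M := fun _ : ι ↦ W) i)
  exact ⟨_, ⟨e.trans <| .piCongrRight fun _ ↦ .ofInjective f hf⟩⟩

/-- If the trace form of `M` vanishes then the multiplicity of each constituent of `M` is divisible
by the characteristic. -/
theorem IsSemisimpleModule.exists_linearEquiv_fun_of_trace_eq_zero (p : ℕ) [CharP k p] [NeZero p]
    {M : Type*} [AddCommGroup M] [Module k M] [Module A M] [IsScalarTower k A M]
    [FiniteDimensional k M] [IsSemisimpleModule A M]
    (h : ∀ a : A, LinearMap.trace k M (Algebra.lsmul k k M a) = 0) :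
    ∃ W : Submodule A M, Nonempty (M ≃ₗ[A] (Fin p → W)) := by
  cases subsingleton_or_nontrivial M with
  | inl _ => exact ⟨⊥, ⟨LinearEquiv.ofSubsingleton _ _⟩⟩
  | inr _ =>
  have : Finite M := Module.finite_of_finite k
  obtain ⟨S, hS⟩ := IsSemisimpleModule.exists_simple_submodule A M
  obtain ⟨D, hD⟩ := exists_isCompl (isotypicComponent A M S)
  set C := isotypicComponent A M S
  have key {T : Submodule A M} (hT : T ≤ D) (hTS : Nonempty (T ≃ₗ[A] S)) :
      ¬ IsSimpleModule A T := fun hs ↦ by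
    have hle : T ≤ C := le_sSup hTS
    exact (isSimpleModule_iff_isAtom.mp hs).1 (le_bot_iff.mp (hD.disjoint hle hT))
  have hiso : IsIsotypicOfType A C S := .isotypicComponent A M S
  have hCD (f : C →ₗ[A] D) : f = 0 := by
    by_contra hf
    obtain ⟨U, T, hU, ⟨e⟩⟩ := LinearMap.exists_isSimpleModule_linearEquiv_of_ne_zero hf
    let e' := T.equivMapOfInjective D.subtype D.subtype_injective
    exact key (D.map_subtype_le T) ⟨(e.trans e').symm.trans (hiso U).some⟩
      (.congr (e.trans e').symm)
  have hDC (f : D →ₗ[A] C) : f = 0 := by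
    by_contra hf
    obtain ⟨T, U, hT, ⟨e⟩⟩ := LinearMap.exists_isSimpleModule_linearEquiv_of_ne_zero hf
    have : IsSimpleModule A U := .congr e.symm
    let e' := T.equivMapOfInjective D.subtype D.subtype_injective
    exact key (D.map_subtype_le T) ⟨e'.symm.trans (e.trans (hiso U).some)⟩ (.congr e'.symm)
  obtain ⟨a₀, h₁, h₀⟩ := IsSemisimpleModule.exists_smul_eq_self_and_smul_eq_zero hCD hDC
  let eM := Submodule.prodEquivOfIsCompl C D hD
  have hsum (a : A) : LinearMap.trace k C (Algebra.lsmul k k C a) +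
      LinearMap.trace k D (Algebra.lsmul k k D a) = 0 := by
    rw [← LinearMap.trace_lsmul_prod, eM.trace_lsmul_eq, h]
  have hC0 (a : A) : LinearMap.trace k C (Algebra.lsmul k k C a) = 0 := by
    have h₁' : Algebra.lsmul k k C (a * a₀) = Algebra.lsmul k k C a := by
      ext x; simp [h₁]
    have h₀' : Algebra.lsmul k k D (a * a₀) = 0 := by
      ext x; simp [h₀]
    simpa [h₁', h₀'] using hsum (a * a₀)
  have hD0 (a : A) : LinearMap.trace k D (Algebra.lsmul k k D a) = 0 := by
    simpa [hC0] using hsum a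
  obtain ⟨n, ⟨eC⟩⟩ := hiso.linearEquiv_fun
  obtain ⟨a, ha⟩ := IsSimpleModule.exists_trace_lsmul_ne_zero k A S
  have hpn : p ∣ n := by
    have := hC0 a
    rw [eC.trace_lsmul_eq, LinearMap.trace_lsmul_fin_fun] at this
    exact (CharP.cast_eq_zero_iff k p n).mp ((mul_eq_zero_iff_right ha).mp this)
  obtain ⟨q, rfl⟩ := hpn
  have hlt : Module.finrank k D < Module.finrank k M := by
    have : Nontrivial C := Submodule.nontrivial_iff_ne_bot.mpr (bot_lt_isotypicComponent S).ne'
    have h₁ : 0 < Module.finrank k C := Module.finrank_pos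
    have h₂ := (eM.restrictScalars k).finrank_eq
    rw [Module.finrank_prod] at h₂
    omega
  obtain ⟨W, ⟨eD⟩⟩ := IsSemisimpleModule.exists_linearEquiv_fun_of_trace_eq_zero p hD0
  let eC' : C ≃ₗ[A] (Fin p → Fin q → S) :=
    eC.trans ((LinearEquiv.funCongrLeft A S finProdFinEquiv).trans (LinearEquiv.curry A S _ _))
  let e : M ≃ₗ[A] (Fin p → (Fin q → S) × W) := eM.symm.trans <| (eC'.prodCongr eD).trans
    { Equiv.arrowProdEquivProdArrow (Fin p) (fun _ ↦ Fin q → S) (fun _ ↦ W) |>.symm with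
      map_add' := fun _ _ ↦ rfl
      map_smul' := fun _ _ ↦ rfl }
  exact Submodule.exists_linearEquiv_fun_of_linearEquiv e
termination_by Module.finrank k M

/-- **Brauer–Nesbitt** for modules over an algebra over a finite field. -/
theorem IsSemisimpleModule.nonempty_linearEquiv_of_charpoly_eq
    {s : Set A} (hs₁ : 1 ∈ s) (hs : Submodule.span k s = ⊤)
    {M N : Type*} [AddCommGroup M] [Module k M] [Module A M] [IsScalarTower k A M]
    [FiniteDimensional k M] [IsSemisimpleModule A M]
    [AddCommGroup N] [Module k N] [Module A N] [IsScalarTower k A N]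
    [FiniteDimensional k N] [IsSemisimpleModule A N]
    (h : ∀ a ∈ s, (Algebra.lsmul k k M a).charpoly = (Algebra.lsmul k k N a).charpoly) :
    Nonempty (M ≃ₗ[A] N) := by
  have hrank : Module.finrank k M = Module.finrank k N := by
    simpa [LinearMap.charpoly_natDegree] using congr(($(h 1 hs₁)).natDegree)
  cases subsingleton_or_nontrivial M with
  | inl _ =>
    have : Subsingleton N := by
      rwa [← Module.finrank_eq_zero_iff_of_free (R := k), ← hrank,
        Module.finrank_eq_zero_iff_of_free]
    exact ⟨LinearEquiv.ofSubsingleton _ _⟩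
  | inr _ =>
  have : Finite M := Module.finite_of_finite k
  have : Finite N := Module.finite_of_finite k
  by_cases hcommon : ∃ (S : Submodule A M) (S' : Submodule A N),
      IsSimpleModule A S ∧ Nonempty (S ≃ₗ[A] S')
  · obtain ⟨S, S', hS, ⟨e⟩⟩ := hcommon
    obtain ⟨T, hT⟩ := exists_isCompl S
    obtain ⟨T', hT'⟩ := exists_isCompl S'
    let eM := Submodule.prodEquivOfIsCompl S T hT
    let eN := Submodule.prodEquivOfIsCompl S' T' hT'
    have hTT (a : A) (ha : a ∈ s) :
        (Algebra.lsmul k k T a).charpoly = (Algebra.lsmul k k T' a).charpoly := by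
      have := h a ha
      rw [← eM.charpoly_lsmul_eq, ← eN.charpoly_lsmul_eq, LinearMap.charpoly_lsmul_prod,
        LinearMap.charpoly_lsmul_prod, e.charpoly_lsmul_eq] at this
      exact mul_left_cancel₀ (LinearMap.charpoly_monic _).ne_zero this
    have hlt : Module.finrank k T < Module.finrank k M := by
      have := IsSimpleModule.nontrivial A S
      have h₁ : 0 < Module.finrank k S := Module.finrank_pos
      have h₂ := (eM.restrictScalars k).finrank_eq
      rw [Module.finrank_prod] at h₂
      omega
    obtain ⟨eT⟩ := IsSemisimpleModule.nonempty_linearEquiv_of_charpoly_eq hs₁ hs hTT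
    exact ⟨eM.symm.trans ((e.prodCongr eT).trans eN)⟩
  · have hMN (f : M →ₗ[A] N) : f = 0 := by
      by_contra hf
      exact hcommon (LinearMap.exists_isSimpleModule_linearEquiv_of_ne_zero hf)
    have hNM (f : N →ₗ[A] M) : f = 0 := by
      by_contra hf
      obtain ⟨S, S', hS, ⟨e⟩⟩ := LinearMap.exists_isSimpleModule_linearEquiv_of_ne_zero hf
      exact hcommon ⟨S', S, .congr e.symm, ⟨e.symm⟩⟩
    have htr (a : A) : LinearMap.trace k M (Algebra.lsmul k k M a) =
        LinearMap.trace k N (Algebra.lsmul k k N a) := by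
      have : LinearMap.trace k M ∘ₗ (Algebra.lsmul k k M).toLinearMap =
          LinearMap.trace k N ∘ₗ (Algebra.lsmul k k N).toLinearMap :=
        LinearMap.ext_on hs fun a ha ↦ by
          simp [LinearMap.trace_eq_neg_charpoly_nextCoeff, h a ha]
      exact congr($this a)
    obtain ⟨a₀, h₁, h₀⟩ := IsSemisimpleModule.exists_smul_eq_self_and_smul_eq_zero hMN hNM
    have hM0 (a : A) : LinearMap.trace k M (Algebra.lsmul k k M a) = 0 := by
      have h₁' : Algebra.lsmul k k M (a * a₀) = Algebra.lsmul k k M a := by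
        ext x; simp [h₁]
      have h₀' : Algebra.lsmul k k N (a * a₀) = 0 := by
        ext x; simp [h₀]
      simpa [h₁', h₀'] using htr (a * a₀)
    have hN0 (a : A) : LinearMap.trace k N (Algebra.lsmul k k N a) = 0 := by
      rw [← htr, hM0]
    obtain ⟨p, hp⟩ := CharP.exists k
    have : Fact p.Prime := ⟨CharP.char_is_prime k p⟩
    obtain ⟨W, ⟨eM⟩⟩ := IsSemisimpleModule.exists_linearEquiv_fun_of_trace_eq_zero p hM0
    obtain ⟨W', ⟨eN⟩⟩ := IsSemisimpleModule.exists_linearEquiv_fun_of_trace_eq_zero p hN0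
    have hWW (a : A) (ha : a ∈ s) :
        (Algebra.lsmul k k W a).charpoly = (Algebra.lsmul k k W' a).charpoly := by
      have := h a ha
      rw [eM.charpoly_lsmul_eq, eN.charpoly_lsmul_eq, LinearMap.charpoly_lsmul_fin_fun,
        LinearMap.charpoly_lsmul_fin_fun] at this
      exact frobenius_inj k[X] p this
    have hlt : Module.finrank k W < Module.finrank k M := by
      have h₁ : 0 < Module.finrank k M := Module.finrank_pos
      have h₂ := (eM.restrictScalars k).finrank_eq
      rw [Module.finrank_pi_fintype] at h₂
      simp only [Finset.sum_const, Finset.card_univ, Fintype.card_fin, smul_eq_mul] at h₂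
      have h₃ := (Fact.out : p.Prime).two_le
      nlinarith
    obtain ⟨eW⟩ := IsSemisimpleModule.nonempty_linearEquiv_of_charpoly_eq hs₁ hs hWW
    exact ⟨eM.trans ((LinearEquiv.piCongrRight fun _ ↦ eW).trans eN.symm)⟩
termination_by Module.finrank k M

end Pow

theorem Matrix.natDegree_charpolyRev_one (R : Type*) [CommRing R] [IsDomain R] (n : ℕ) :
    (1 : Matrix (Fin n) (Fin n) R).charpolyRev.natDegree = n := by
  have h : (1 : Matrix (Fin n) (Fin n) R).charpolyRev = (1 - X) ^ n := by
    have : (1 - (X : R[X]) • (1 : Matrix (Fin n) (Fin n) R).map C) =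
        (1 - X : R[X]) • (1 : Matrix (Fin n) (Fin n) R[X]) := by
      rw [Matrix.map_one _ (map_zero C) (map_one C), sub_smul, one_smul]
    rw [charpolyRev, this, Matrix.det_smul]
    simp
  have h' : (1 - X : R[X]).natDegree = 1 := by
    rw [← neg_sub, natDegree_neg, ← C_1, natDegree_X_sub_C]
  rw [h, natDegree_pow, h', mul_one]

theorem Matrix.reflect_charpolyRev {R : Type*} [CommRing R] [Nontrivial R] {n : ℕ}
    (M : Matrix (Fin n) (Fin n) R) : M.charpolyRev.reflect n = M.charpoly := by
  rw [← Matrix.reverse_charpoly, reverse, Matrix.charpoly_natDegree_eq_dim, Fintype.card_fin,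
    reflect_reflect]



theorem Representation.charpoly_lsmul_of {k G W : Type*} [Group G] [Field k] [AddCommGroup W]
    [Module k W] [FiniteDimensional k W] (σ : Representation k G W) (g : G) :
    (Algebra.lsmul k k σ.asModule (MonoidAlgebra.of k G g)).charpoly = (σ g).charpoly := by
  rw [← σ.asModuleEquiv.charpoly_conj]
  congr 1
  ext v
  change σ.asModuleEquiv (MonoidAlgebra.of k G g • σ.asModuleEquiv.symm v) = σ g v
  rw [σ.asModuleEquiv_map_smul, asAlgebraHom_of, LinearEquiv.apply_symm_apply]

/-- Brauer–Nesbitt: over a finite field, two finite-dimensional semisimple representations of a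
group whose characteristic polynomials `det (Id - X ρ(g))` agree for all `g` are isomorphic. -/
theorem stmt_6 {G : Type*} [Group G] {k : Type*} [Field k] [Finite k]
    {V V' : Type*} [AddCommGroup V] [Module k V] [FiniteDimensional k V]
    [AddCommGroup V'] [Module k V'] [FiniteDimensional k V']
    (ρ : Representation k G V) (ρ' : Representation k G V')
    (hss : IsSemisimpleModule (MonoidAlgebra k G) ρ.asModule)
    (hss' : IsSemisimpleModule (MonoidAlgebra k G) ρ'.asModule)
    (hcp : ∀ g : G,
      ((1 : Matrix (Fin (Module.finrank k V)) (Fin (Module.finrank k V)) k[X]) -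
          (X : k[X]) • ((LinearMap.toMatrix (Module.finBasis k V) (Module.finBasis k V))
            (ρ g)).map C).det =
      ((1 : Matrix (Fin (Module.finrank k V')) (Fin (Module.finrank k V')) k[X]) -
          (X : k[X]) • ((LinearMap.toMatrix (Module.finBasis k V') (Module.finBasis k V'))
            (ρ' g)).map C).det) :
    ∃ e : V ≃ₗ[k] V', ∀ g : G, ∀ v : V, e (ρ g v) = ρ' g (e v) := by
  have hrank : Module.finrank k V = Module.finrank k V' := by
    have h := hcp 1
    rw [map_one ρ, map_one ρ', Module.End.one_eq_id, Module.End.one_eq_id, LinearMap.toMatrix_id,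
      LinearMap.toMatrix_id] at h
    have h' := congr(($h).natDegree)
    rwa [← Matrix.charpolyRev, ← Matrix.charpolyRev, Matrix.natDegree_charpolyRev_one,
      Matrix.natDegree_charpolyRev_one] at h'
  have hchar (g : G) : (ρ g).charpoly = (ρ' g).charpoly := by
    rw [← LinearMap.charpoly_toMatrix (ρ g) (Module.finBasis k V),
      ← LinearMap.charpoly_toMatrix (ρ' g) (Module.finBasis k V'),
      ← Matrix.reflect_charpolyRev, ← Matrix.reflect_charpolyRev, Matrix.charpolyRev,
      Matrix.charpolyRev, hcp g, hrank]
  have hs : Submodule.span k (Set.range (MonoidAlgebra.of k G)) = ⊤ := by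
    rw [← top_le_iff]
    intro a _
    exact MonoidAlgebra.mem_span_support_coeff a |> Submodule.span_mono (Set.image_subset_range _ _)
  obtain ⟨e⟩ := IsSemisimpleModule.nonempty_linearEquiv_of_charpoly_eq
    (s := Set.range (MonoidAlgebra.of k G)) ⟨1, map_one _⟩ hs (M := ρ.asModule) (N := ρ'.asModule)
    (by rintro _ ⟨g, rfl⟩; rw [ρ.charpoly_lsmul_of, ρ'.charpoly_lsmul_of, hchar])
  refine ⟨ρ.asModuleEquiv.symm.trans ((e.restrictScalars k).trans ρ'.asModuleEquiv),
    fun g v ↦ ?_⟩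
  change ρ'.asModuleEquiv (e (ρ.asModuleEquiv.symm (ρ g v))) =
    ρ' g (ρ'.asModuleEquiv (e (ρ.asModuleEquiv.symm v)))
  rw [ρ.asModuleEquiv_symm_map_rho, map_smul, ρ'.asModuleEquiv_map_smul,
    Representation.asAlgebraHom_of]
end

section
/- Wirsing's theorem: let ω : ℕ → ℝ be a nonnegative multiplicative function (ω(1) = 1 and ω(mn) = ω(m)ω(n) whenever gcd(m,n) = 1), let α > 0, and suppose that (i) ∑_{p ≤ N, p prime} ω(p) log p = (α + o(1)) N as N → ∞, and (ii) there exist constants γ₁ > 0 and 0 < γ₂ < 2 such that ω(p^k) ≤ γ₁ γ₂^k for every prime p and every k ≥ 1. Then, as N → ∞, ∑_{n ≤ N} ω(n) = (1 + o(1)) · (e^{−γα}/Γ(α)) · (N/log N) · ∏_{p ≤ N} ( ∑_{k=0}^∞ ω(p^k) p^{−k} ), where γ is the Euler–Mascheroni constant and Γ is the Gamma function. -/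
open Filter

namespace Wirsing

open Finset Real Topology MeasureTheory

/-- The summatory function of `c` in logarithmic scale. -/
noncomputable def expSum (c : ℕ → ℝ) (u : ℝ) : ℝ := ∑ n ∈ Ioc 0 ⌊exp u⌋₊, c n

/-- The primitive of `expSum c`. -/
noncomputable def expSumInt (c : ℕ → ℝ) (u : ℝ) : ℝ := ∑ n ∈ Ioc 0 ⌊exp u⌋₊, c n * (u - log n)

lemma mem_Ioc_floor_exp {n : ℕ} {u : ℝ} : n ∈ Ioc 0 ⌊exp u⌋₊ ↔ 0 < n ∧ log n ≤ u := by
  rw [Finset.mem_Ioc]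
  refine and_congr_right fun h => ?_
  rw [Nat.le_floor_iff (exp_pos u).le, log_le_iff_le_exp (by exact_mod_cast h)]

lemma expSum_log {c : ℕ → ℝ} {N : ℕ} (hN : 0 < N) : expSum c (log N) = ∑ n ∈ Ioc 0 N, c n := by
  rw [expSum, exp_log (by exact_mod_cast hN), Nat.floor_natCast]

lemma expSum_eq_sum {c : ℕ → ℝ} {u : ℝ} {N : ℕ} (hN : ⌊exp u⌋₊ ≤ N) :
    expSum c u = ∑ n ∈ Ioc 0 N, c n * if log n ≤ u then 1 else 0 := by
  simp only [mul_ite, mul_one, mul_zero]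
  rw [expSum, ← Finset.sum_filter]
  refine Finset.sum_congr ?_ fun _ _ => rfl
  ext n
  rw [mem_Ioc_floor_exp, Finset.mem_filter, Finset.mem_Ioc]
  refine ⟨fun h => ⟨⟨h.1, ?_⟩, h.2⟩, fun h => ⟨h.1.1, h.2⟩⟩
  exact (Finset.mem_Ioc.1 (mem_Ioc_floor_exp.2 h)).2.trans hN

lemma expSumInt_eq_sum {c : ℕ → ℝ} {u : ℝ} {N : ℕ} (hN : ⌊exp u⌋₊ ≤ N) :
    expSumInt c u = ∑ n ∈ Ioc 0 N, c n * max 0 (u - log n) := by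
  have h : ∀ n ∈ Ioc 0 ⌊exp u⌋₊, c n * (u - log n) = c n * max 0 (u - log n) := fun n hn => by
    rw [max_eq_right (sub_nonneg.2 (mem_Ioc_floor_exp.1 hn).2)]
  rw [expSumInt, Finset.sum_congr rfl h]
  refine Finset.sum_subset (Finset.Ioc_subset_Ioc_right hN) fun n hn hn' => ?_
  rw [mem_Ioc_floor_exp] at hn'
  have : u < log n := by
    by_contra hlt
    exact hn' ⟨(Finset.mem_Ioc.1 hn).1, not_lt.1 hlt⟩
  rw [max_eq_left (by linarith), mul_zero]

lemma floor_exp_mono {u v : ℝ} (h : u ≤ v) : ⌊exp u⌋₊ ≤ ⌊exp v⌋₊ :=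
  Nat.floor_mono (exp_le_exp.2 h)

lemma expSum_mono {c : ℕ → ℝ} (hc : ∀ n, 0 ≤ c n) : Monotone (expSum c) := fun _ _ h =>
  Finset.sum_le_sum_of_subset_of_nonneg (Finset.Ioc_subset_Ioc_right (floor_exp_mono h))
    fun _ _ _ => hc _

lemma expSum_nonneg {c : ℕ → ℝ} (hc : ∀ n, 0 ≤ c n) (u : ℝ) : 0 ≤ expSum c u :=
  Finset.sum_nonneg fun _ _ => hc _

lemma one_mem_Ioc_floor_exp {u : ℝ} (hu : 0 ≤ u) : 1 ∈ Ioc 0 ⌊exp u⌋₊ := by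
  simp [hu]

lemma expSum_pos {c : ℕ → ℝ} (hc : ∀ n, 0 ≤ c n) (hc1 : 0 < c 1) {u : ℝ} (hu : 0 ≤ u) :
    0 < expSum c u :=
  hc1.trans_le (Finset.single_le_sum (f := c) (fun _ _ => hc _) (one_mem_Ioc_floor_exp hu))

lemma expSumInt_pos {c : ℕ → ℝ} (hc : ∀ n, 0 ≤ c n) (hc1 : 0 < c 1) {u : ℝ} (hu : 0 < u) :
    0 < expSumInt c u := by
  have h := Finset.single_le_sum (f := fun n : ℕ => c n * (u - log n))
    (fun n hn => mul_nonneg (hc n) (sub_nonneg.2 (mem_Ioc_floor_exp.1 hn).2))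
    (one_mem_Ioc_floor_exp hu.le)
  refine lt_of_lt_of_le ?_ h
  simp only [Nat.cast_one, log_one, sub_zero]
  positivity

lemma continuousOn_expSumInt (c : ℕ → ℝ) (a b : ℝ) : ContinuousOn (expSumInt c) (Set.Icc a b) := by
  have h : ContinuousOn (fun u : ℝ => ∑ n ∈ Ioc 0 ⌊exp b⌋₊, c n * max 0 (u - log n))
      (Set.Icc a b) := by fun_prop
  exact h.congr fun u hu => expSumInt_eq_sum (floor_exp_mono hu.2)

lemma hasDerivWithinAt_max_zero_sub (a u : ℝ) :
    HasDerivWithinAt (fun u : ℝ => max 0 (u - a)) (if a ≤ u then 1 else 0) (Set.Ici u) u := by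
  split_ifs with h
  · have : HasDerivWithinAt (fun u : ℝ => u - a) 1 (Set.Ici u) u :=
      ((hasDerivAt_id u).sub_const a).hasDerivWithinAt
    exact this.congr (fun x hx => max_eq_right (sub_nonneg.2 (h.trans hx)))
      (max_eq_right (sub_nonneg.2 h))
  · have : HasDerivAt (fun u : ℝ => max 0 (u - a)) 0 u := by
      refine (hasDerivAt_const u (0 : ℝ)).congr_of_eventuallyEq ?_
      filter_upwards [eventually_lt_nhds (not_le.1 h)] with x hx
      exact max_eq_left (by linarith)
    exact this.hasDerivWithinAt

lemma hasDerivWithinAt_expSumInt (c : ℕ → ℝ) (u : ℝ) :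
    HasDerivWithinAt (expSumInt c) (expSum c u) (Set.Ici u) u := by
  have hle : u ≤ u + 1 := by linarith
  have h : HasDerivWithinAt (fun x : ℝ => ∑ n ∈ Ioc 0 ⌊exp (u + 1)⌋₊, c n * max 0 (x - log n))
      (∑ n ∈ Ioc 0 ⌊exp (u + 1)⌋₊, c n * if log n ≤ u then 1 else 0) (Set.Ici u) u :=
    HasDerivWithinAt.fun_sum fun n _ => (hasDerivWithinAt_max_zero_sub (log n) u).const_mul (c n)
  rw [expSum_eq_sum (floor_exp_mono hle)]
  refine h.congr_of_eventuallyEq ?_ (expSumInt_eq_sum (floor_exp_mono hle))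
  filter_upwards [mem_nhdsWithin_of_mem_nhds (eventually_lt_nhds (lt_add_one u))] with x hx
  exact expSumInt_eq_sum (floor_exp_mono hx.le)

section RegularVariation

variable {c : ℕ → ℝ} {κ : ℝ}

/-- An approximate Euler relation between `expSum c` and its primitive. -/
def EulerRelation (c : ℕ → ℝ) (κ : ℝ) : Prop :=
  ∀ δ > 0, ∃ C : ℝ, ∀ u ≥ 0,
    |u * expSum c u - κ * expSumInt c u| ≤ (δ * u + C) * expSum c u

lemma EulerRelation.tendsto_expSumInt_div (h : EulerRelation c κ) (hc : ∀ n, 0 ≤ c n)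
    (hc1 : 0 < c 1) :
    Tendsto (fun u => κ * expSumInt c u / (u * expSum c u)) atTop (𝓝 1) := by
  rw [Metric.tendsto_atTop]
  intro ε hε
  obtain ⟨C, hC⟩ := h (ε / 4) (by positivity)
  refine ⟨max 1 (4 * |C| / ε), fun u hu => ?_⟩
  have hu1 : 1 ≤ u := (le_max_left _ _).trans hu
  have hu2 : 4 * |C| / ε ≤ u := (le_max_right _ _).trans hu
  have hu0 : 0 < u := by linarith
  have hA := expSum_pos hc hc1 hu0.le
  have h1 := hC u hu0.le
  rw [div_le_iff₀ hε] at hu2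
  have hC' : C ≤ u * ε / 4 := by linarith [le_abs_self C]
  rw [dist_eq_norm, Real.norm_eq_abs, abs_sub_comm, one_sub_div (by positivity), abs_div,
    abs_of_pos (mul_pos hu0 hA), div_lt_iff₀ (by positivity)]
  refine h1.trans_lt ?_
  have : (ε / 4 * u + C) * expSum c u ≤ (ε / 2 * u) * expSum c u := by
    gcongr; linarith
  have h3 : 0 < ε * (u * expSum c u) := by positivity
  nlinarith

lemma EulerRelation.tendsto_expSum_div (h : EulerRelation c κ) (hκ : κ ≠ 0) (hc : ∀ n, 0 ≤ c n)
    (hc1 : 0 < c 1) :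
    Tendsto (fun u => u * expSum c u / expSumInt c u) atTop (𝓝 κ) := by
  have h1 := ((h.tendsto_expSumInt_div hc hc1).inv₀ one_ne_zero).const_mul κ
  rw [inv_one, mul_one] at h1
  refine h1.congr fun u => ?_
  rw [inv_div, mul_div_assoc', mul_div_mul_left _ _ hκ]

lemma EulerRelation.log_expSumInt (h : EulerRelation c κ) (hκ : κ ≠ 0) (hc : ∀ n, 0 ≤ c n)
    (hc1 : 0 < c 1) {ε : ℝ} (hε : 0 < ε) :
    ∃ U > 0, ∀ u ≥ U, ∀ v ≥ u,
      |log (expSumInt c v) - log (expSumInt c u) - κ * (log v - log u)| ≤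
        ε * (log v - log u) := by
  obtain ⟨U, hU⟩ := Metric.tendsto_atTop.1 (h.tendsto_expSum_div hκ hc hc1) ε hε
  refine ⟨max U 1, by positivity, fun u hu v hv => ?_⟩
  have hu1 : 1 ≤ u := (le_max_right _ _).trans hu
  have hu0 : 0 < u := by linarith
  have hcont : ContinuousOn (fun x => log (expSumInt c x)) (Set.Icc u v) :=
    (continuousOn_expSumInt c u v).log fun x hx => (expSumInt_pos hc hc1 (hu0.trans_le hx.1)).ne'
  have hderiv : ∀ x ∈ Set.Ico u v, HasDerivWithinAt (fun x => log (expSumInt c x))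
      (expSum c x / expSumInt c x) (Set.Ici x) x := fun x hx =>
    (hasDerivWithinAt_expSumInt c x).log (expSumInt_pos hc hc1 (hu0.trans_le hx.1)).ne'
  have hbound : ∀ x ∈ Set.Ico u v, |expSum c x / expSumInt c x - κ / x| ≤ ε / x := fun x hx => by
    have hx0 : 0 < x := hu0.trans_le hx.1
    have := (hU x ((le_max_left _ _).trans (hu.trans hx.1))).le
    rw [dist_eq_norm, Real.norm_eq_abs] at this
    rw [le_div_iff₀ hx0, ← abs_of_pos hx0, ← abs_mul, abs_of_pos hx0]
    convert! this using 2
    field_simp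
  have hlog : ∀ r : ℝ, ContinuousOn (fun x => log (expSumInt c u) + r * (log x - log u))
      (Set.Icc u v) := fun r => by
    refine continuousOn_const.add (continuousOn_const.mul (ContinuousOn.sub ?_ continuousOn_const))
    exact continuousOn_log.mono fun x hx => (hu0.trans_le hx.1).ne'
  have hlog' : ∀ r : ℝ, ∀ x ∈ Set.Ico u v,
      HasDerivWithinAt (fun x => log (expSumInt c u) + r * (log x - log u)) (r / x)
        (Set.Ici x) x := fun r x hx => by
    have := (((Real.hasDerivAt_log (hu0.trans_le hx.1).ne').sub_const (log u)).const_mul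
      r).const_add (log (expSumInt c u))
    exact this.hasDerivWithinAt
  have h1 := image_le_of_deriv_right_le_deriv_boundary hcont hderiv (by simp) (hlog (κ + ε))
    (hlog' (κ + ε)) (fun x hx => by
      rw [add_div]; linarith [(abs_le.1 (hbound x hx)).2]) (Set.right_mem_Icc.2 hv)
  have h2 := image_le_of_deriv_right_le_deriv_boundary (hlog (κ - ε)) (hlog' (κ - ε)) (by simp)
    hcont hderiv (fun x hx => by
      rw [sub_div]; linarith [(abs_le.1 (hbound x hx)).1]) (Set.right_mem_Icc.2 hv)
  rw [abs_le]
  constructor <;> linarith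

lemma EulerRelation.tendsto_expSumInt_mul_div (h : EulerRelation c κ) (hκ : κ ≠ 0)
    (hc : ∀ n, 0 ≤ c n) (hc1 : 0 < c 1) {v : ℝ} (hv : 1 ≤ v) :
    Tendsto (fun u => expSumInt c (u * v) / expSumInt c u) atTop (𝓝 (v ^ κ)) := by
  have hv0 : 0 < v := by linarith
  suffices hlog : Tendsto (fun u => log (expSumInt c (u * v)) - log (expSumInt c u)) atTop
      (𝓝 (κ * log v)) by
    have h1 := (continuous_exp.tendsto _).comp hlog
    rw [rpow_def_of_pos hv0, mul_comm (log v)]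
    refine h1.congr' ?_
    filter_upwards [eventually_gt_atTop 0] with u hu
    have p1 := expSumInt_pos hc hc1 (mul_pos hu hv0)
    have p2 := expSumInt_pos hc hc1 hu
    simp only [Function.comp_apply]
    rw [exp_sub, exp_log p1, exp_log p2]
  rw [Metric.tendsto_atTop]
  intro ε hε
  have hl : 0 ≤ log v := log_nonneg hv
  obtain ⟨U, hU0, hU⟩ := h.log_expSumInt hκ hc hc1 (ε := ε / (log v + 1)) (by positivity)
  refine ⟨U, fun u hu => ?_⟩
  have hu0 : 0 < u := hU0.trans_le hu
  have := hU u hu (u * v) (le_mul_of_one_le_right hu0.le hv)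
  rw [log_mul hu0.ne' hv0.ne', add_sub_cancel_left] at this
  rw [dist_eq_norm, Real.norm_eq_abs]
  refine this.trans_lt ?_
  rw [div_mul_eq_mul_div, div_lt_iff₀ (by positivity)]
  nlinarith

lemma EulerRelation.tendsto_expSum_mul_div_of_one_le (h : EulerRelation c κ) (hκ : κ ≠ 0)
    (hc : ∀ n, 0 ≤ c n) (hc1 : 0 < c 1) {v : ℝ} (hv : 1 ≤ v) :
    Tendsto (fun u => expSum c (u * v) / expSum c u) atTop (𝓝 (v ^ (κ - 1))) := by
  have hv0 : 0 < v := by linarith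
  have h1 := h.tendsto_expSum_div hκ hc hc1
  have h2 := h1.comp (tendsto_id.atTop_mul_const hv0)
  have h3 := ((h2.div h1 hκ).mul (h.tendsto_expSumInt_mul_div hκ hc hc1 hv)).div_const v
  rw [div_self hκ, one_mul, ← rpow_sub_one hv0.ne'] at h3
  refine h3.congr' ?_
  filter_upwards [eventually_gt_atTop 0] with u hu
  have p1 := expSumInt_pos hc hc1 (mul_pos hu hv0)
  have p2 := expSumInt_pos hc hc1 hu
  have p3 := expSum_pos hc hc1 hu.le
  simp only [Pi.div_apply, Function.comp_apply, id]
  field_simp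

/-- `expSum c` is regularly varying of index `κ - 1`. -/
lemma EulerRelation.tendsto_expSum_mul_div (h : EulerRelation c κ) (hκ : κ ≠ 0)
    (hc : ∀ n, 0 ≤ c n) (hc1 : 0 < c 1) {v : ℝ} (hv : 0 < v) :
    Tendsto (fun u => expSum c (u * v) / expSum c u) atTop (𝓝 (v ^ (κ - 1))) := by
  rcases le_total 1 v with h1 | h1
  · exact h.tendsto_expSum_mul_div_of_one_le hκ hc hc1 h1
  have h2 := (h.tendsto_expSum_mul_div_of_one_le hκ hc hc1 ((one_le_inv₀ hv).2 h1)).comp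
    (tendsto_id.atTop_mul_const hv)
  have h3 := h2.inv₀ (rpow_pos_of_pos (inv_pos.2 hv) _).ne'
  rw [inv_rpow hv.le, inv_inv] at h3
  refine h3.congr fun u => ?_
  simp only [Function.comp_apply, id]
  rw [inv_div, mul_inv_cancel_right₀ hv.ne']

lemma EulerRelation.expSum_mul_le (h : EulerRelation c κ) (hκ : 0 < κ)
    (hc : ∀ n, 0 ≤ c n) (hc1 : 0 < c 1) :
    ∀ᶠ u in atTop, ∀ v ≥ 1, expSum c (u * v) ≤ 4 * v ^ κ * expSum c u := by
  obtain ⟨U, hU0, hU⟩ := h.log_expSumInt hκ.ne' hc hc1 one_pos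
  have h1 := h.tendsto_expSum_div hκ.ne' hc hc1
  obtain ⟨U1, hU1⟩ := eventually_atTop.1 ((h1.eventually (eventually_gt_nhds (half_lt_self hκ))).and
    (h1.eventually (eventually_lt_nhds (show κ < 2 * κ by linarith))))
  filter_upwards [eventually_ge_atTop U, eventually_ge_atTop U1] with u hu hu1 v hv
  have hv0 : 0 < v := by linarith
  have hu0 : 0 < u := hU0.trans_le hu
  have hle : u ≤ u * v := le_mul_of_one_le_right hu0.le hv
  have p1 := expSumInt_pos hc hc1 (mul_pos hu0 hv0)
  have p2 := expSumInt_pos hc hc1 hu0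
  have h2 := (hU1 (u * v) (hu1.trans hle)).2
  have h3 := (hU1 u hu1).1
  rw [div_lt_iff₀ p1] at h2
  rw [lt_div_iff₀ p2] at h3
  have h4 := (abs_le.1 (hU u hu (u * v) hle)).2
  rw [log_mul hu0.ne' hv0.ne', add_sub_cancel_left] at h4
  have h5 : log (expSumInt c (u * v)) ≤ log (v ^ (κ + 1) * expSumInt c u) := by
    rw [log_mul (rpow_pos_of_pos hv0 _).ne' p2.ne', log_rpow hv0]
    linarith
  rw [log_le_log_iff p1 (by positivity), rpow_add_one hv0.ne'] at h5
  have h6 : u * v * expSum c (u * v) ≤ u * v * (4 * v ^ κ * expSum c u) := by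
    have hw : 0 < v ^ κ * v := by positivity
    calc u * v * expSum c (u * v) ≤ 2 * κ * (v ^ κ * v * expSumInt c u) := by
          refine h2.le.trans ?_
          gcongr
      _ = 4 * (v ^ κ * v) * (κ / 2 * expSumInt c u) := by ring
      _ ≤ 4 * (v ^ κ * v) * (u * expSum c u) := by gcongr
      _ = _ := by ring
  exact le_of_mul_le_mul_left h6 (by positivity)

end RegularVariation

section Laplace

variable {c : ℕ → ℝ}

/-- Abel summation against a nonnegative kernel. -/
lemma hasSum_mul_integral_Ioi (hc : ∀ n, 0 ≤ c n) (hc0 : c 0 = 0) {k : ℝ → ℝ}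
    (hk : ∀ v > 0, 0 ≤ k v) (hkm : AEStronglyMeasurable k (volume.restrict (Set.Ioi 0)))
    {U : ℝ} (hU : 0 < U)
    (hint : IntegrableOn (fun v => expSum c (U * v) * k v) (Set.Ioi 0)) :
    HasSum (fun n : ℕ => c n * ∫ v in Set.Ioi (log n / U), k v)
      (∫ v in Set.Ioi 0, expSum c (U * v) * k v) := by
  set F : ℕ → ℝ → ℝ := fun n v => c n * (Set.Ici (log n / U)).indicator k v with hF
  have hF0 : ∀ n, ∀ v > 0, 0 ≤ F n v := fun n v hv =>
    mul_nonneg (hc n) (Set.indicator_apply_nonneg fun _ => hk v hv)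
  have hzero : ∀ n v, n ∉ Ioc 0 ⌊exp (U * v)⌋₊ → F n v = 0 := fun n v hn => by
    rcases Nat.eq_zero_or_pos n with rfl | hpos
    · simp [hF, hc0]
    · rw [mem_Ioc_floor_exp, not_and, not_le] at hn
      have : v ∉ Set.Ici (log n / U) := by
        rw [Set.mem_Ici, not_le, lt_div_iff₀ hU, mul_comm]
        exact hn hpos
      simp [hF, Set.indicator_of_notMem this]
  have hsum : ∀ v, ∑ n ∈ Ioc 0 ⌊exp (U * v)⌋₊, F n v = expSum c (U * v) * k v := fun v => by
    rw [expSum, Finset.sum_mul]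
    refine Finset.sum_congr rfl fun n hn => ?_
    have : v ∈ Set.Ici (log n / U) := by
      rw [Set.mem_Ici, div_le_iff₀ hU, mul_comm]
      exact (mem_Ioc_floor_exp.1 hn).2
    simp [hF, Set.indicator_of_mem this]
  have hle : ∀ (s : Finset ℕ), ∀ v > 0, ∑ n ∈ s, F n v ≤ expSum c (U * v) * k v :=
    fun s v hv => by
      rw [← hsum]
      calc ∑ n ∈ s, F n v ≤ ∑ n ∈ s ∪ Ioc 0 ⌊exp (U * v)⌋₊, F n v :=
            Finset.sum_le_sum_of_subset_of_nonneg Finset.subset_union_left fun n _ _ => hF0 n v hv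
        _ = _ := (Finset.sum_subset Finset.subset_union_right fun n _ hn => hzero n v hn).symm
  have hFint : ∀ n, Integrable (F n) (volume.restrict (Set.Ioi 0)) := fun n => by
    refine Integrable.mono' hint ((hkm.indicator measurableSet_Ici).const_mul _) ?_
    filter_upwards [ae_restrict_mem measurableSet_Ioi] with v hv
    rw [norm_of_nonneg (hF0 n v hv)]
    simpa using hle {n} v hv
  have hFnorm : ∀ n, ∫ v in Set.Ioi 0, ‖F n v‖ = ∫ v in Set.Ioi 0, F n v := fun n =>
    setIntegral_congr_fun measurableSet_Ioi fun v hv => norm_of_nonneg (hF0 n v hv)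
  have hsummable : Summable fun n => ∫ v in Set.Ioi 0, ‖F n v‖ := by
    simp only [hFnorm]
    refine summable_of_sum_range_le (c := ∫ v in Set.Ioi 0, expSum c (U * v) * k v)
      (fun n => setIntegral_nonneg measurableSet_Ioi fun v hv => hF0 n v hv) fun N => ?_
    rw [← integral_finsetSum _ fun n _ => hFint n]
    exact setIntegral_mono_on (integrable_finsetSum _ fun n _ => hFint n) hint measurableSet_Ioi
      fun v hv => hle _ v hv
  have h := hasSum_integral_of_summable_integral_norm hFint hsummable
  have htsum : ∀ v, ∑' n, F n v = expSum c (U * v) * k v := fun v => by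
    rw [tsum_eq_sum fun n hn => hzero n v hn, hsum]
  simp only [htsum] at h
  convert! h using 2 with n
  rcases Nat.eq_zero_or_pos n with rfl | hpos
  · simp [hF, hc0]
  rw [hF, integral_const_mul, setIntegral_indicator measurableSet_Ici]
  have h0 : 0 ≤ log n / U := div_nonneg (log_natCast_nonneg n) hU.le
  congr 1
  refine setIntegral_congr_set ?_
  rcases h0.eq_or_lt with h0 | h0
  · rw [← h0, Set.inter_eq_left.2 Set.Ioi_subset_Ici_self]
    exact EventuallyEq.rfl
  · rw [Set.inter_eq_right.2 (Set.Ici_subset_Ioi.2 h0)]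
    exact Ioi_ae_eq_Ici

variable {κ : ℝ}

lemma EulerRelation.laplace (h : EulerRelation c κ) (hκ : 0 < κ) (hc : ∀ n, 0 ≤ c n)
    (hc0 : c 0 = 0) (hc1 : 0 < c 1) :
    (∀ᶠ u in atTop, Summable fun n : ℕ => c n * exp (-(log n / u))) ∧
      Tendsto (fun u => (∑' n : ℕ, c n * exp (-(log n / u))) / expSum c u) atTop
        (𝓝 (Gamma κ)) := by
  set bound : ℝ → ℝ := fun v => exp (-v) * v ^ ((1 : ℝ) - 1) + 4 * (exp (-v) * v ^ (κ + 1 - 1))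
    with hbound
  have hbint : IntegrableOn bound (Set.Ioi 0) :=
    (GammaIntegral_convergent one_pos).add
      ((GammaIntegral_convergent (by linarith : 0 < κ + 1)).const_mul 4)
  have hmeas : ∀ u, AEStronglyMeasurable (fun v => expSum c (u * v) / expSum c u * exp (-v))
      (volume.restrict (Set.Ioi 0)) := fun u => by
    have h1 : Measurable fun v => expSum c (u * v) :=
      (expSum_mono hc).measurable.comp (measurable_const_mul u)
    have : Measurable fun v => expSum c (u * v) / expSum c u * exp (-v) := by fun_prop
    exact this.aestronglyMeasurable
  have hle : ∀ᶠ u in atTop, ∀ᵐ v ∂(volume.restrict (Set.Ioi 0)),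
      ‖expSum c (u * v) / expSum c u * exp (-v)‖ ≤ bound v := by
    filter_upwards [h.expSum_mul_le hκ hc hc1, eventually_gt_atTop 0] with u hu hu0
    filter_upwards [ae_restrict_mem measurableSet_Ioi] with v hv
    have hv0 : (0 : ℝ) < v := hv
    have hA := expSum_pos hc hc1 hu0.le
    rw [norm_of_nonneg (mul_nonneg (div_nonneg (expSum_nonneg hc _) hA.le) (exp_pos _).le)]
    simp only [hbound, sub_self, rpow_zero, mul_one, add_sub_cancel_right]
    have hp : 0 ≤ v ^ κ := by positivity
    have : expSum c (u * v) / expSum c u ≤ 1 + 4 * v ^ κ := by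
      rw [div_le_iff₀ hA]
      rcases le_total v 1 with h1 | h1
      · have := expSum_mono hc (mul_le_of_le_one_right hu0.le h1)
        nlinarith [mul_nonneg hp hA.le]
      · linarith [hu v h1]
    calc expSum c (u * v) / expSum c u * exp (-v) ≤ (1 + 4 * v ^ κ) * exp (-v) := by gcongr
      _ = _ := by ring
  have hlim := tendsto_integral_filter_of_dominated_convergence bound
    (Eventually.of_forall hmeas) hle hbint (f := fun v => exp (-v) * v ^ (κ - 1)) (by
      filter_upwards [ae_restrict_mem measurableSet_Ioi] with v hv
      rw [mul_comm (exp (-v))]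
      exact (h.tendsto_expSum_mul_div hκ.ne' hc hc1 hv).mul_const _)
  rw [← Gamma_eq_integral hκ] at hlim
  have hsum : ∀ᶠ u in atTop, HasSum (fun n : ℕ => c n * exp (-(log n / u)))
      (∫ v in Set.Ioi 0, expSum c (u * v) * exp (-v)) := by
    filter_upwards [hle, eventually_gt_atTop 0] with u hu hu0
    have hA := expSum_pos hc hc1 hu0.le
    have hint : IntegrableOn (fun v => expSum c (u * v) * exp (-v)) (Set.Ioi 0) := by
      refine IntegrableOn.congr_fun (f := fun v => expSum c u *
        (expSum c (u * v) / expSum c u * exp (-v)))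
        ((Integrable.mono' hbint (hmeas u) hu).const_mul _) (fun v _ => ?_) measurableSet_Ioi
      simp only
      field_simp
    have := hasSum_mul_integral_Ioi hc hc0 (k := fun v => exp (-v)) (fun v _ => (exp_pos _).le)
      (by fun_prop) hu0 hint
    simpa only [integral_exp_neg_Ioi] using this
  refine ⟨hsum.mono fun u hu => hu.summable, hlim.congr' ?_⟩
  filter_upwards [hsum] with u hu
  rw [hu.tsum_eq, ← integral_div]
  congr 1
  ext v
  ring

end Laplace

section Kernel

/-- The indicator function of `(-∞, 1]`. -/
noncomputable def unitStep : ℝ → ℝ := (Set.Iic (1 : ℝ)).indicator fun _ => 1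

lemma unitStep_of_le {v : ℝ} (h : v ≤ 1) : unitStep v = 1 :=
  Set.indicator_of_mem (Set.mem_Iic.2 h) _

lemma unitStep_of_lt {v : ℝ} (h : 1 < v) : unitStep v = 0 :=
  Set.indicator_of_notMem (fun h' => not_le.2 h (Set.mem_Iic.1 h')) _

lemma unitStep_nonneg (v : ℝ) : 0 ≤ unitStep v :=
  Set.indicator_nonneg (fun _ _ => zero_le_one) v

@[fun_prop]
lemma measurable_unitStep : Measurable unitStep := measurable_const.indicator measurableSet_Iic

lemma setIntegral_mul_unitStep (f : ℝ → ℝ) (a : ℝ) :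
    ∫ v in Set.Ioi a, f v * unitStep v = ∫ v in Set.Ioc a 1, f v := by
  have : (fun v => f v * unitStep v) = (Set.Iic 1).indicator f := by
    ext v
    by_cases h : v ∈ Set.Iic 1
    · rw [Set.indicator_of_mem h, unitStep_of_le h, mul_one]
    · rw [Set.indicator_of_notMem h, unitStep_of_lt (not_le.1 h), mul_zero]
  rw [this, setIntegral_indicator measurableSet_Iic, Set.Ioi_inter_Iic]

lemma integrableOn_unitStep : IntegrableOn unitStep (Set.Ioi 0) := by
  rw [unitStep, integrableOn_indicator_iff measurableSet_Iic, Set.inter_comm, Set.Ioi_inter_Iic]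
  exact integrableOn_const measure_Ioc_lt_top.ne

lemma integrableOn_exp_neg_add_unitStep :
    IntegrableOn (fun v => exp (-v) + unitStep v) (Set.Ioi 0) :=
  (integrableOn_exp_neg_Ioi 0).add integrableOn_unitStep

lemma abs_exp_neg_sub_unitStep_mul_rpow_le {v t : ℝ} (hv : 0 < v) (ht0 : 0 ≤ t) (ht1 : t ≤ 1) :
    |(exp (-v) - unitStep v) * v ^ (t - 1)| ≤ exp (-v) + unitStep v := by
  have hp : 0 ≤ v ^ (t - 1) := by positivity
  have he := (exp_pos (-v)).le
  rw [abs_mul, abs_of_nonneg hp]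
  rcases le_or_gt v 1 with h | h
  · rw [unitStep_of_le h, abs_sub_comm, abs_of_nonneg (by simpa using hv.le)]
    calc (1 - exp (-v)) * v ^ (t - 1) ≤ v * v ^ (t - 1) := by
          gcongr; linarith [one_sub_le_exp_neg v]
      _ = v ^ t := by rw [rpow_sub_one hv.ne', mul_div_cancel₀ _ hv.ne']
      _ ≤ 1 := rpow_le_one hv.le h ht0
      _ ≤ _ := by linarith
  · rw [unitStep_of_lt h, sub_zero, add_zero, abs_of_nonneg he]
    exact mul_le_of_le_one_right he (rpow_le_one_of_one_le_of_nonpos h.le (by linarith))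

lemma integral_exp_neg_sub_unitStep_mul_rpow {t : ℝ} (ht : 0 < t) :
    ∫ v in Set.Ioi 0, (exp (-v) - unitStep v) * v ^ (t - 1) = t⁻¹ * (Gamma (1 + t) - Gamma 1) := by
  have h1 := GammaIntegral_convergent ht
  have h2 : IntegrableOn (fun v => v ^ (t - 1) * unitStep v) (Set.Ioi 0) := by
    have : (fun v => v ^ (t - 1) * unitStep v) = (Set.Iic 1).indicator fun v => v ^ (t - 1) := by
      ext v
      by_cases h : v ∈ Set.Iic 1
      · rw [Set.indicator_of_mem h, unitStep_of_le h, mul_one]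
      · rw [Set.indicator_of_notMem h, unitStep_of_lt (not_le.1 h), mul_zero]
    rw [this, integrableOn_indicator_iff measurableSet_Iic, Set.inter_comm, Set.Ioi_inter_Iic,
      ← intervalIntegrable_iff_integrableOn_Ioc_of_le zero_le_one]
    exact intervalIntegral.intervalIntegrable_rpow' (by linarith)
  have h3 : ∀ v : ℝ, (exp (-v) - unitStep v) * v ^ (t - 1) =
      exp (-v) * v ^ (t - 1) - v ^ (t - 1) * unitStep v := fun v => by ring
  simp only [h3]
  rw [integral_sub h1 h2, ← Gamma_eq_integral ht, setIntegral_mul_unitStep,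
    ← intervalIntegral.integral_of_le zero_le_one, integral_rpow (Or.inl (by linarith)),
    add_comm 1 t, Gamma_add_one ht.ne', Gamma_one]
  simp only [sub_add_cancel, one_rpow, zero_rpow ht.ne', sub_zero]
  field_simp

lemma integral_exp_neg_sub_unitStep_div :
    ∫ v in Set.Ioi 0, (exp (-v) - unitStep v) / v = -eulerMascheroniConstant := by
  have h1 : Tendsto (fun t : ℝ => t⁻¹ * (Gamma (1 + t) - Gamma 1)) (𝓝[>] 0)
      (𝓝 (-eulerMascheroniConstant)) :=
    (hasDerivAt_iff_tendsto_slope_zero.1 hasDerivAt_Gamma_one).mono_left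
      (nhdsWithin_mono _ fun x hx => (ne_of_gt hx : x ≠ 0))
  have hmem : ∀ᶠ t : ℝ in 𝓝[>] 0, t ∈ Set.Ioo (0 : ℝ) 1 := Ioo_mem_nhdsGT one_pos
  refine tendsto_nhds_unique (tendsto_integral_filter_of_dominated_convergence
    (fun v => exp (-v) + unitStep v) (F := fun t v => (exp (-v) - unitStep v) * v ^ (t - 1))
    ?_ ?_ integrableOn_exp_neg_add_unitStep ?_) (h1.congr' ?_)
  · refine Eventually.of_forall fun t => Measurable.aestronglyMeasurable ?_
    fun_prop
  · filter_upwards [hmem] with t ht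
    filter_upwards [ae_restrict_mem measurableSet_Ioi] with v hv
    exact abs_exp_neg_sub_unitStep_mul_rpow_le hv ht.1.le ht.2.le
  · filter_upwards [ae_restrict_mem measurableSet_Ioi] with v hv
    have hv0 : (0 : ℝ) < v := hv
    have : ContinuousAt (fun t : ℝ => (exp (-v) - unitStep v) * v ^ (t - 1)) 0 := by
      fun_prop (disch := exact hv0.ne')
    have h2 := this.tendsto.mono_left (nhdsWithin_le_nhds (s := Set.Ioi 0))
    simpa [rpow_neg_one, div_eq_mul_inv] using h2
  · filter_upwards [hmem] with t ht
    exact (integral_exp_neg_sub_unitStep_mul_rpow ht.1).symm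

lemma abs_exp_neg_sub_unitStep_div_le {v : ℝ} (hv : 0 < v) :
    |(exp (-v) - unitStep v) / v| ≤ exp (-v) + unitStep v := by
  simpa [rpow_neg_one, div_eq_mul_inv] using
    abs_exp_neg_sub_unitStep_mul_rpow_le hv le_rfl zero_le_one

lemma integrableOn_exp_neg_sub_unitStep_div :
    IntegrableOn (fun v => (exp (-v) - unitStep v) / v) (Set.Ioi 0) := by
  refine Integrable.mono' integrableOn_exp_neg_add_unitStep
    (Measurable.aestronglyMeasurable (by fun_prop)) ?_
  filter_upwards [ae_restrict_mem measurableSet_Ioi] with v hv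
  exact abs_exp_neg_sub_unitStep_div_le hv

lemma integral_exp_neg_mul_inv_add {a : ℝ} (ha : 0 < a) :
    ∫ v in Set.Ioi a, exp (-v) * (1 / v + 1 / v ^ 2) = exp (-a) / a := by
  have h := integral_Ioi_of_hasDerivAt_of_nonneg' (a := a) (l := 0)
    (g := fun v => -(exp (-v) / v)) (g' := fun v => exp (-v) * (1 / v + 1 / v ^ 2))
    (fun v hv => ?_) (fun v hv => ?_) ?_
  · rw [h, zero_sub, neg_neg]
  · have hv0 : v ≠ 0 := (ha.trans_le hv).ne'
    have := (((hasDerivAt_id v).neg.exp).div (hasDerivAt_id v) hv0).neg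
    convert! this using 1
    simp only [Pi.neg_apply, id]
    field_simp
    ring
  · have hv0 : 0 < v := ha.trans hv
    positivity
  · have h1 : Tendsto (fun v : ℝ => exp (-v)) atTop (𝓝 0) := tendsto_exp_neg_atTop_nhds_zero
    simpa using (h1.div_atTop tendsto_id).neg

lemma integral_unitStep_div_sq {a : ℝ} (ha : 0 < a) :
    ∫ v in Set.Ioi a, 1 / v ^ 2 * unitStep v = max 0 (1 / a - 1) := by
  rw [setIntegral_mul_unitStep]
  rcases le_total a 1 with h | h
  · have hpos : ∀ v ∈ Set.uIcc a 1, v ≠ 0 := fun v hv => by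
      rw [Set.uIcc_of_le h] at hv
      exact (ha.trans_le hv.1).ne'
    rw [← intervalIntegral.integral_of_le h,
      intervalIntegral.integral_eq_sub_of_hasDerivAt (f := fun v => -v⁻¹)
        (fun v hv => (hasDerivAt_inv (hpos v hv)).neg.congr_deriv (by simp)),
      max_eq_right (by rw [sub_nonneg, le_div_iff₀ ha]; linarith)]
    · simp; ring
    · refine ContinuousOn.intervalIntegrable (continuousOn_const.div (by fun_prop) fun v hv => ?_)
      exact pow_ne_zero 2 (hpos v hv)
  · rw [Set.Ioc_eq_empty (not_lt.2 h), setIntegral_empty, max_eq_left]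
    rw [sub_nonpos, div_le_one ha]
    exact h

end Kernel

section PrimeSum

variable {d : ℕ → ℝ} {α : ℝ}

lemma expSum_eq_zero_of_lt (hd1 : d 1 = 0) {u : ℝ} (hu : u < log 2) : expSum d u = 0 := by
  refine Finset.sum_eq_zero fun n hn => ?_
  rw [mem_Ioc_floor_exp] at hn
  have : n < 2 := by
    by_contra! h
    have := log_le_log two_pos (show (2 : ℝ) ≤ n by exact_mod_cast h)
    linarith [hn.2]
  obtain rfl : n = 1 := by omega
  exact hd1

lemma exists_expSum_le_mul (hd : ∀ n, 0 ≤ d n) (hd1 : d 1 = 0)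
    (h : Tendsto (fun u => expSum d u / u) atTop (𝓝 α)) :
    ∃ C, 0 ≤ C ∧ ∀ u > 0, expSum d u ≤ C * u := by
  obtain ⟨U, hU⟩ := eventually_atTop.1 (h.eventually (eventually_lt_nhds (lt_add_one α)))
  have hl : 0 < log 2 := log_pos one_lt_two
  have hs := expSum_nonneg hd U
  refine ⟨|α| + 1 + expSum d U / log 2, by positivity, fun u hu => ?_⟩
  rw [add_mul]
  rcases lt_or_ge u (log 2) with h1 | h1
  · rw [expSum_eq_zero_of_lt hd1 h1]
    positivity
  rcases le_total U u with h2 | h2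
  · have h3 := hU u h2
    rw [div_lt_iff₀ hu] at h3
    have : (α + 1) * u ≤ (|α| + 1) * u := by gcongr; exact le_abs_self α
    have h4 : 0 ≤ expSum d U / log 2 * u := by positivity
    linarith
  · have h3 : expSum d u ≤ expSum d U / log 2 * u := by
      rw [div_mul_eq_mul_div, le_div_iff₀ hl]
      have := expSum_mono hd h2
      gcongr
    have : 0 ≤ (|α| + 1) * u := by positivity
    linarith

/-- Comparison of a smoothly damped sum over primes with the sharply truncated one. -/
lemma tendsto_tsum_sub_expSum (hd : ∀ n, 0 ≤ d n) (hd0 : d 0 = 0) (hd1 : d 1 = 0)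
    (h : Tendsto (fun u => expSum d u / u) atTop (𝓝 α)) :
    (∀ u > 0, Summable fun n : ℕ => d n / log n * exp (-(log n / u))) ∧
      Tendsto (fun u => (∑' n : ℕ, d n / log n * exp (-(log n / u))) -
        expSum (fun n => d n / log n) u) atTop (𝓝 (-(eulerMascheroniConstant * α))) := by
  obtain ⟨C, hC0, hC⟩ := exists_expSum_le_mul hd hd1 h
  set k₁ : ℝ → ℝ := fun v => exp (-v) * (1 / v + 1 / v ^ 2) with hk₁
  set k₂ : ℝ → ℝ := fun v => 1 / v ^ 2 * unitStep v with hk₂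
  have hl : 0 < log 2 := log_pos one_lt_two
  have hdmeas : ∀ u : ℝ, Measurable fun v => expSum d (u * v) := fun u =>
    (expSum_mono hd).measurable.comp (measurable_const_mul u)
  have hk₁0 : ∀ v > 0, 0 ≤ k₁ v := fun v hv => by
    simp only [hk₁]
    positivity
  have hk₂0 : ∀ v > 0, 0 ≤ k₂ v := fun v hv => mul_nonneg (by positivity) (unitStep_nonneg v)
  have hk₁m : Measurable k₁ := by fun_prop
  have hk₂m : Measurable k₂ := by fun_prop
  have hbd : ∀ u > 0, ∀ v > 0, expSum d (u * v) * (1 / v ^ 2) ≤ C * u * (u / log 2) ∧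
      expSum d (u * v) * (1 / v) ≤ C * u := fun u hu v hv => by
    have h2 : expSum d (u * v) * (1 / v) ≤ C * u := by
      rw [mul_one_div, div_le_iff₀ hv, mul_assoc]
      exact hC _ (mul_pos hu hv)
    refine ⟨?_, h2⟩
    rcases lt_or_ge (u * v) (log 2) with h1 | h1
    · rw [expSum_eq_zero_of_lt hd1 h1, zero_mul]
      positivity
    · have h3 : 1 / v ≤ u / log 2 := by
        rw [div_le_div_iff₀ hv hl, one_mul]
        exact h1
      calc expSum d (u * v) * (1 / v ^ 2) = expSum d (u * v) * (1 / v) * (1 / v) := by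
            field_simp
        _ ≤ _ := by gcongr
  have hint₁ : ∀ u > 0, IntegrableOn (fun v => expSum d (u * v) * k₁ v) (Set.Ioi 0) :=
    fun u hu => by
      have hm := hdmeas u
      refine Integrable.mono' (((integrableOn_exp_neg_Ioi 0).const_mul
        (C * u * (u / log 2) + C * u))) (Measurable.aestronglyMeasurable (by fun_prop)) ?_
      filter_upwards [ae_restrict_mem measurableSet_Ioi] with v hv
      rw [norm_of_nonneg (mul_nonneg (expSum_nonneg hd _) (hk₁0 v hv))]
      obtain ⟨h1, h2⟩ := hbd u hu v hv
      calc expSum d (u * v) * k₁ v = (expSum d (u * v) * (1 / v ^ 2) +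
            expSum d (u * v) * (1 / v)) * exp (-v) := by simp only [hk₁]; ring
        _ ≤ _ := by gcongr
  have hint₂ : ∀ u > 0, IntegrableOn (fun v => expSum d (u * v) * k₂ v) (Set.Ioi 0) :=
    fun u hu => by
      have hm := hdmeas u
      refine Integrable.mono' (integrableOn_unitStep.const_mul
        (C * u * (u / log 2))) (Measurable.aestronglyMeasurable (by fun_prop)) ?_
      filter_upwards [ae_restrict_mem measurableSet_Ioi] with v hv
      rw [norm_of_nonneg (mul_nonneg (expSum_nonneg hd _) (hk₂0 v hv))]
      simp only [hk₂]
      rw [← mul_assoc]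
      exact mul_le_mul_of_nonneg_right (hbd u hu v hv).1 (unitStep_nonneg v)
  have hlogpos : ∀ n : ℕ, d n ≠ 0 → 0 < log n := fun n hn => by
    refine log_pos ?_
    by_contra! hle
    have : n ≤ 1 := by exact_mod_cast hle
    interval_cases n <;> contradiction
  have hs₁ : ∀ u > 0, HasSum (fun n : ℕ => u * (d n / log n * exp (-(log n / u))))
      (∫ v in Set.Ioi 0, expSum d (u * v) * k₁ v) := fun u hu => by
    convert! hasSum_mul_integral_Ioi hd hd0 hk₁0 hk₁m.aestronglyMeasurable hu (hint₁ u hu)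
      using 2 with n
    by_cases hn : d n = 0
    · simp [hn]
    have := hlogpos n hn
    rw [integral_exp_neg_mul_inv_add (by positivity)]
    field_simp
  have hs₂ : ∀ u > 0, ∫ v in Set.Ioi 0, expSum d (u * v) * k₂ v =
      u * expSum (fun n => d n / log n) u - expSum d u := fun u hu => by
    refine (hasSum_mul_integral_Ioi hd hd0 hk₂0 hk₂m.aestronglyMeasurable hu
      (hint₂ u hu)).unique ?_
    rw [expSum, expSum, Finset.mul_sum, ← Finset.sum_sub_distrib]
    convert! hasSum_sum_of_ne_finset_zero (L := SummationFilter.unconditional ℕ)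
      (f := fun n : ℕ => d n * ∫ v in Set.Ioi (log n / u), k₂ v) (s := Ioc 0 ⌊exp u⌋₊) ?_ using 1
    · refine Finset.sum_congr rfl fun n hn => ?_
      rw [mem_Ioc_floor_exp] at hn
      by_cases hn0 : d n = 0
      · simp [hn0]
      have := hlogpos n hn0
      rw [integral_unitStep_div_sq (by positivity), max_eq_right]
      · field_simp
      · rw [sub_nonneg, one_div_div, one_le_div this]
        exact hn.2
    · intro n hn
      by_cases hn0 : d n = 0
      · simp [hn0]
      have := hlogpos n hn0
      have hn' : 0 < n := Nat.pos_of_ne_zero (by rintro rfl; exact hn0 hd0)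
      rw [mem_Ioc_floor_exp, not_and, not_le] at hn
      rw [integral_unitStep_div_sq (by positivity), max_eq_left, mul_zero]
      rw [sub_nonpos, one_div_div, div_le_one this]
      exact (hn hn').le
  refine ⟨fun u hu => (summable_mul_left_iff hu.ne').1 (hs₁ u hu).summable, ?_⟩
  set w : ℝ → ℝ := fun v => exp (-v) + (exp (-v) - unitStep v) / v with hw
  have hwint : IntegrableOn w (Set.Ioi 0) :=
    (integrableOn_exp_neg_Ioi 0).add integrableOn_exp_neg_sub_unitStep_div
  have hwm : Measurable w := by fun_prop
  have hwI : ∫ v in Set.Ioi 0, α * w v = α * (1 - eulerMascheroniConstant) := by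
    rw [integral_const_mul, hw, integral_add (integrableOn_exp_neg_Ioi 0)
      integrableOn_exp_neg_sub_unitStep_div, integral_exp_neg_sub_unitStep_div,
      integral_exp_neg_Ioi_zero, sub_eq_add_neg]
  have hlim : Tendsto (fun u => ∫ v in Set.Ioi 0, expSum d (u * v) / (u * v) * w v) atTop
      (𝓝 (∫ v in Set.Ioi 0, α * w v)) := by
    refine tendsto_integral_filter_of_dominated_convergence (fun v => C * ‖w v‖) ?_ ?_
      (hwint.norm.const_mul C) ?_
    · refine Eventually.of_forall fun u => Measurable.aestronglyMeasurable ?_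
      have := hdmeas u
      fun_prop
    · filter_upwards [eventually_gt_atTop 0] with u hu
      filter_upwards [ae_restrict_mem measurableSet_Ioi] with v hv
      have huv : 0 < u * v := mul_pos hu hv
      rw [norm_mul, norm_of_nonneg (div_nonneg (expSum_nonneg hd _) huv.le)]
      gcongr
      rw [div_le_iff₀ huv]
      exact hC _ huv
    · filter_upwards [ae_restrict_mem measurableSet_Ioi] with v hv
      exact (h.comp (tendsto_id.atTop_mul_const (hv : (0 : ℝ) < v))).mul_const _
  have key := hlim.sub h
  rw [hwI, show α * (1 - eulerMascheroniConstant) - α = -(eulerMascheroniConstant * α) by ring]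
    at key
  refine key.congr' ?_
  filter_upwards [eventually_gt_atTop 0] with u hu
  have e1 : ∫ v in Set.Ioi 0, expSum d (u * v) / (u * v) * w v =
      u⁻¹ * ((∫ v in Set.Ioi 0, expSum d (u * v) * k₁ v) -
        ∫ v in Set.Ioi 0, expSum d (u * v) * k₂ v) := by
    rw [← integral_sub (hint₁ u hu) (hint₂ u hu), ← integral_const_mul]
    refine setIntegral_congr_fun measurableSet_Ioi fun v hv => ?_
    have hv0 : (0 : ℝ) < v := hv
    simp only [hw, hk₁, hk₂]
    field_simp
    ring
  rw [e1, hs₂ u hu, ← (hs₁ u hu).tsum_eq, tsum_mul_left]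
  field_simp
  ring

end PrimeSum

section Convolution

/-- The Dirichlet convolution of two functions on the natural numbers. -/
def conv (f g : ℕ → ℝ) (n : ℕ) : ℝ := ∑ x ∈ n.divisorsAntidiagonal, f x.1 * g x.2

lemma sum_conv (f g : ℕ → ℝ) (N : ℕ) :
    ∑ n ∈ Ioc 0 N, conv f g n = ∑ m ∈ Ioc 0 N, f m * ∑ d ∈ Ioc 0 (N / m), g d := by
  set f' : ArithmeticFunction ℝ := ⟨fun n => if n = 0 then 0 else f n, by simp⟩ with hf'
  set g' : ArithmeticFunction ℝ := ⟨fun n => if n = 0 then 0 else g n, by simp⟩ with hg'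
  have hf : ∀ n ≠ 0, f' n = f n := fun n hn => by simp [hf', hn]
  have hg : ∀ n ≠ 0, g' n = g n := fun n hn => by simp [hg', hn]
  have h := ArithmeticFunction.sum_Ioc_mul_eq_sum_sum f' g' N
  have e1 : ∑ n ∈ Ioc 0 N, conv f g n = ∑ n ∈ Ioc 0 N, (f' * g') n := by
    refine Finset.sum_congr rfl fun n hn => ?_
    rw [conv, ArithmeticFunction.mul_apply]
    refine Finset.sum_congr rfl fun x hx => ?_
    have hx0 := Nat.ne_zero_of_mem_divisorsAntidiagonal hx
    rw [hf _ hx0.1, hg _ hx0.2]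
  rw [e1, h]
  refine Finset.sum_congr rfl fun m hm => ?_
  rw [hf m (Finset.mem_Ioc.1 hm).1.ne']
  congr 1
  exact Finset.sum_congr rfl fun d hd => hg d (Finset.mem_Ioc.1 hd).1.ne'

lemma conv_div (f g : ℕ → ℝ) (n : ℕ) :
    conv (fun m => f m / m) (fun m => g m / m) n = conv f g n / n := by
  rw [conv, conv, Finset.sum_div]
  refine Finset.sum_congr rfl fun x hx => ?_
  rw [← (Nat.mem_divisorsAntidiagonal.1 hx).1, Nat.cast_mul, div_mul_div_comm]

end Convolution

section Arithmetic

variable {ω : ℕ → ℝ}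

/-- The function `n ↦ ω n * log n` restricted to the primes. -/
noncomputable def primeLog (ω : ℕ → ℝ) (n : ℕ) : ℝ := if n.Prime then ω n * log n else 0

/-- A majorant, supported on proper prime powers, for the defect in
`n ↦ ω n * log n` being the convolution of `ω` with `primeLog ω`. -/
noncomputable def correction (ω : ℕ → ℝ) (n : ℕ) : ℝ :=
  if IsPrimePow n ∧ ¬ n.Prime then
    ω n * log n + ω (n / n.minFac) * (ω n.minFac * log n.minFac) else 0

lemma primeLog_nonneg (hnn : ∀ n, 0 ≤ ω n) (n : ℕ) : 0 ≤ primeLog ω n := by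
  rw [primeLog]
  split_ifs
  · exact mul_nonneg (hnn n) (log_natCast_nonneg n)
  · rfl

lemma correction_nonneg (hnn : ∀ n, 0 ≤ ω n) (n : ℕ) : 0 ≤ correction ω n := by
  rw [correction]
  split_ifs
  · exact add_nonneg (mul_nonneg (hnn _) (log_natCast_nonneg _))
      (mul_nonneg (hnn _) (mul_nonneg (hnn _) (log_natCast_nonneg _)))
  · rfl

lemma correction_prime_pow {p k : ℕ} (hp : p.Prime) (hk : 2 ≤ k) :
    correction ω (p ^ k) = ω (p ^ k) * (k * log p) + ω (p ^ (k - 1)) * (ω p * log p) := by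
  have h1 : IsPrimePow (p ^ k) := hp.isPrimePow.pow (by omega)
  have h2 : ¬ (p ^ k).Prime := Nat.Prime.not_prime_pow hk
  rw [correction, if_pos ⟨h1, h2⟩, hp.pow_minFac (by omega), Nat.cast_pow, log_pow]
  congr 3
  rw [Nat.div_eq_iff_eq_mul_left hp.pos (dvd_pow_self p (by omega)), ← pow_succ]
  congr 1
  omega

lemma conv_primeLog {n : ℕ} :
    conv ω (primeLog ω) n = ∑ p ∈ n.primeFactors, ω (n / p) * (ω p * log p) := by
  rw [conv, Nat.sum_divisorsAntidiagonal' (f := fun a b => ω a * primeLog ω b),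
    Nat.primeFactors_eq_to_filter_divisors_prime, Finset.sum_filter]
  refine Finset.sum_congr rfl fun d _ => ?_
  rw [primeLog, mul_ite, mul_zero]

lemma mul_log_eq_sum (n : ℕ) :
    ω n * log n = ∑ p ∈ n.primeFactors, ω n * (n.factorization p * log p) := by
  rw [← Finset.mul_sum, log_nat_eq_sum_factorization, Finsupp.sum, Nat.support_factorization]

lemma abs_local_defect_le (hnn : ∀ n, 0 ≤ ω n)
    (hmult : ∀ m n : ℕ, Nat.Coprime m n → ω (m * n) = ω m * ω n)
    {n p : ℕ} (hn : n ≠ 0) (hp : p ∈ n.primeFactors) :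
    |ω n * (n.factorization p * log p) - ω (n / p) * (ω p * log p)| ≤
      ω (n / p ^ n.factorization p) * correction ω (p ^ n.factorization p) := by
  have hpp := Nat.prime_of_mem_primeFactors hp
  have hv : 0 < n.factorization p :=
    hpp.factorization_pos_of_dvd hn (Nat.dvd_of_mem_primeFactors hp)
  have hco := Nat.coprime_ordCompl hpp hn
  have hmul := Nat.ordProj_mul_ordCompl_eq_self n p
  set v := n.factorization p
  set m := n / p ^ v
  have h1 : ω n = ω (p ^ v) * ω m := by rw [← hmult _ _ (hco.pow_left v), hmul]
  have h2 : ω (n / p) = ω (p ^ (v - 1)) * ω m := by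
    rw [← hmult _ _ (hco.pow_left _)]
    congr 1
    rw [← hmul]
    refine Nat.div_eq_of_eq_mul_left hpp.pos ?_
    rw [mul_right_comm, ← pow_succ, Nat.sub_add_cancel hv]
  have hl : 0 ≤ log p := log_natCast_nonneg p
  rw [h1, h2]
  rcases (show v = 1 ∨ 2 ≤ v by omega) with h | h
  · rw [h, pow_one, Nat.sub_self, pow_zero, Nat.cast_one, one_mul]
    have hω1 : ω 1 * ω m = ω m := by rw [← hmult _ _ (Nat.coprime_one_left m), one_mul]
    rw [hω1, show ω p * ω m * log p - ω m * (ω p * log p) = 0 by ring, abs_zero]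
    exact mul_nonneg (hnn _) (correction_nonneg hnn _)
  · rw [correction_prime_pow hpp h,
      show ω (p ^ v) * ω m * (v * log p) - ω (p ^ (v - 1)) * ω m * (ω p * log p) =
        ω m * (ω (p ^ v) * (v * log p) - ω (p ^ (v - 1)) * (ω p * log p)) by ring,
      abs_mul, abs_of_nonneg (hnn m)]
    refine mul_le_mul_of_nonneg_left ((abs_sub _ _).trans_eq ?_) (hnn m)
    rw [abs_of_nonneg (mul_nonneg (hnn _) (by positivity)),
      abs_of_nonneg (mul_nonneg (hnn _) (mul_nonneg (hnn _) hl))]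

lemma abs_mul_log_sub_conv_le (hnn : ∀ n, 0 ≤ ω n)
    (hmult : ∀ m n : ℕ, Nat.Coprime m n → ω (m * n) = ω m * ω n) {n : ℕ} (hn : n ≠ 0) :
    |ω n * log n - conv ω (primeLog ω) n| ≤ conv ω (correction ω) n := by
  rw [conv_primeLog, mul_log_eq_sum, ← Finset.sum_sub_distrib]
  refine (Finset.abs_sum_le_sum_abs _ _).trans
    ((Finset.sum_le_sum fun p hp => abs_local_defect_le hnn hmult hn hp).trans ?_)
  rw [conv, Nat.sum_divisorsAntidiagonal' (f := fun a b => ω a * correction ω b)]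
  have hinj : Set.InjOn (fun p => p ^ n.factorization p) n.primeFactors := fun p hp q hq h => by
    have hpp := Nat.prime_of_mem_primeFactors hp
    have hqq := Nat.prime_of_mem_primeFactors hq
    have hp0 := (hpp.factorization_pos_of_dvd hn (Nat.dvd_of_mem_primeFactors hp)).ne'
    have hq0 := (hqq.factorization_pos_of_dvd hn (Nat.dvd_of_mem_primeFactors hq)).ne'
    rw [← hpp.pow_minFac hp0, ← hqq.pow_minFac hq0]
    exact congrArg Nat.minFac h
  rw [← Finset.sum_image (g := fun p => p ^ n.factorization p)
    (f := fun d => ω (n / d) * correction ω d) hinj]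
  refine Finset.sum_le_sum_of_subset_of_nonneg (fun d hd => ?_)
    fun d _ _ => mul_nonneg (hnn _) (correction_nonneg hnn d)
  obtain ⟨p, -, rfl⟩ := Finset.mem_image.1 hd
  exact Nat.mem_divisors.2 ⟨Nat.ordProj_dvd n p, hn⟩

lemma summable_log_div_sq_primes : Summable fun p : Nat.Primes => log p / (p : ℝ) ^ 2 := by
  have h : Summable fun p : Nat.Primes => 2 * (p : ℝ) ^ (-(3 / 2) : ℝ) :=
    (Nat.Primes.summable_rpow.2 (by norm_num)).mul_left 2
  refine Summable.of_nonneg_of_le (fun p => div_nonneg (log_natCast_nonneg _) (by positivity))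
    (fun p => ?_) h
  have hp : (0 : ℝ) < p := by exact_mod_cast p.2.pos
  rw [div_le_iff₀ (by positivity), mul_assoc, ← rpow_add_natCast hp.ne']
  refine (log_le_rpow_div hp.le (show (0 : ℝ) < 1 / 2 by norm_num)).trans_eq ?_
  norm_num
  ring

lemma summable_correction_div (hnn : ∀ n, 0 ≤ ω n) {γ₁ γ₂ : ℝ} (hγ₁ : 0 < γ₁) (hγ₂0 : 0 < γ₂)
    (hγ₂2 : γ₂ < 2) (hpp : ∀ p k : ℕ, Nat.Prime p → 1 ≤ k → ω (p ^ k) ≤ γ₁ * γ₂ ^ k) :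
    Summable fun n : ℕ => correction ω n / n := by
  have hinj : Function.Injective fun x : Nat.Primes × ℕ => (Nat.Primes.prodNatEquiv x : ℕ) :=
    Subtype.val_injective.comp Nat.Primes.prodNatEquiv.injective
  refine (hinj.summable_iff fun n hn => ?_).1 ?_
  · have : ¬ IsPrimePow n := fun h =>
      hn ⟨Nat.Primes.prodNatEquiv.symm ⟨n, h⟩,
        congrArg Subtype.val (Equiv.apply_symm_apply Nat.Primes.prodNatEquiv ⟨n, h⟩)⟩
    simp [correction, this]
  have hr : Summable fun k : ℕ =>
      4 * (γ₁ + γ₁ ^ 2) * (((k + 1 : ℕ) : ℝ) ^ 1 * (γ₂ / 2) ^ (k + 1)) := by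
    refine Summable.mul_left _ ((summable_nat_add_iff 1).2
      (summable_pow_mul_geometric_of_norm_lt_one (R := ℝ) 1 (r := γ₂ / 2) ?_))
    rw [norm_of_nonneg (by positivity)]
    linarith
  refine Summable.of_nonneg_of_le
    (fun x => div_nonneg (correction_nonneg hnn _) (Nat.cast_nonneg _))
    (fun x => ?_) (summable_log_div_sq_primes.mul_of_nonneg hr
      (fun p => div_nonneg (log_natCast_nonneg _) (by positivity))
      fun k => by simp only [Pi.zero_apply]; positivity)
  obtain ⟨⟨p, hp⟩, k⟩ := x
  change correction ω (p ^ (k + 1)) / ((p ^ (k + 1) : ℕ) : ℝ) ≤ log p / (p : ℝ) ^ 2 *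
    (4 * (γ₁ + γ₁ ^ 2) * (((k + 1 : ℕ) : ℝ) ^ 1 * (γ₂ / 2) ^ (k + 1)))
  have hl : 0 ≤ log p := log_natCast_nonneg p
  have hp2 : (2 : ℝ) ≤ p := by exact_mod_cast hp.two_le
  have hp0 : (0 : ℝ) < p := by linarith
  rcases Nat.eq_zero_or_pos k with rfl | hk
  · have : correction ω (p ^ (0 + 1)) = 0 := by simp [correction, hp]
    rw [this, zero_div]
    positivity
  rw [correction_prime_pow hp (by omega), Nat.add_sub_cancel]
  have h1 := hpp p (k + 1) hp (by omega)
  have h2 := hpp p k hp hk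
  have h3 := hpp p 1 hp le_rfl
  rw [pow_one, pow_one] at h3
  have hk1 : (1 : ℝ) ≤ ((k + 1 : ℕ) : ℝ) := by exact_mod_cast (by omega : 1 ≤ k + 1)
  have hnum : ω (p ^ (k + 1)) * (((k + 1 : ℕ) : ℝ) * log p) + ω (p ^ k) * (ω p * log p) ≤
      log p * ((γ₁ + γ₁ ^ 2) * (((k + 1 : ℕ) : ℝ) * γ₂ ^ (k + 1))) := by
    calc _ ≤ γ₁ * γ₂ ^ (k + 1) * (((k + 1 : ℕ) : ℝ) * log p) +
          γ₁ * γ₂ ^ k * (γ₁ * γ₂ * log p) := by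
          gcongr
          exact mul_nonneg (hnn _) hl
      _ = log p * (γ₁ * (((k + 1 : ℕ) : ℝ) * γ₂ ^ (k + 1)) + γ₁ ^ 2 * (1 * γ₂ ^ (k + 1))) := by
          rw [pow_succ γ₂]; ring
      _ ≤ log p * (γ₁ * (((k + 1 : ℕ) : ℝ) * γ₂ ^ (k + 1)) +
          γ₁ ^ 2 * (((k + 1 : ℕ) : ℝ) * γ₂ ^ (k + 1))) := by gcongr
      _ = _ := by ring
  have hden : (1 : ℝ) / ((p ^ (k + 1) : ℕ) : ℝ) ≤ 4 / (p : ℝ) ^ 2 * (1 / 2 ^ (k + 1)) := by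
    have h4 : (2 / (p : ℝ)) ^ (k + 1) ≤ (2 / (p : ℝ)) ^ 2 :=
      pow_le_pow_of_le_one (by positivity) ((div_le_one hp0).2 hp2) (by omega)
    rw [div_pow, div_pow] at h4
    rw [Nat.cast_pow]
    calc (1 : ℝ) / (p : ℝ) ^ (k + 1) = 2 ^ (k + 1) / (p : ℝ) ^ (k + 1) * (1 / 2 ^ (k + 1)) := by
          field_simp
      _ ≤ 2 ^ 2 / (p : ℝ) ^ 2 * (1 / 2 ^ (k + 1)) := by gcongr
      _ = _ := by norm_num
  rw [div_eq_mul_one_div]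
  calc _ ≤ log p * ((γ₁ + γ₁ ^ 2) * (((k + 1 : ℕ) : ℝ) * γ₂ ^ (k + 1))) *
        (4 / (p : ℝ) ^ 2 * (1 / 2 ^ (k + 1))) :=
        mul_le_mul hnum hden (by positivity) (by positivity)
    _ = _ := by
        rw [div_pow, pow_one]
        ring

end Arithmetic

section PartialSummation

lemma abs_sum_sub_mul_le {g : ℕ → ℝ} {α : ℝ}
    (h : Tendsto (fun N : ℕ => (∑ n ∈ Ioc 0 N, g n) / (N : ℝ)) atTop (𝓝 α)) {δ : ℝ} (hδ : 0 < δ) :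
    ∃ C, 0 ≤ C ∧ ∀ N : ℕ, |∑ n ∈ Ioc 0 N, g n - α * N| ≤ δ * N + C := by
  obtain ⟨N₀, hN₀⟩ := Metric.tendsto_atTop.1 h δ hδ
  refine ⟨∑ N ∈ range (N₀ + 1), |∑ n ∈ Ioc 0 N, g n - α * N|, by positivity, fun N => ?_⟩
  have hsum : 0 ≤ ∑ N ∈ range (N₀ + 1), |∑ n ∈ Ioc 0 N, g n - α * N| := by positivity
  rcases lt_or_ge N (N₀ + 1) with hN | hN
  · have := Finset.single_le_sum (f := fun N : ℕ => |∑ n ∈ Ioc 0 N, g n - α * N|)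
      (fun _ _ => abs_nonneg _) (Finset.mem_range.2 hN)
    have h0 : 0 ≤ δ * N := by positivity
    linarith
  · have hpos : (0 : ℝ) < N := by exact_mod_cast (by omega : 0 < N)
    have := (hN₀ N (by omega)).le
    rw [dist_eq_norm, Real.norm_eq_abs, div_sub' hpos.ne', abs_div, abs_of_pos hpos,
      div_le_iff₀ hpos, mul_comm (N : ℝ)] at this
    linarith

lemma sum_div_eq_sum_partial_sums (e : ℕ → ℝ) (N : ℕ) :
    ∑ n ∈ Ioc 0 N, e n / n = (∑ n ∈ Ioc 0 N, e n) / (N + 1) +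
      ∑ n ∈ Ioc 0 N, (∑ m ∈ Ioc 0 n, e m) / (n * (n + 1)) := by
  induction N with
  | zero => simp
  | succ N ih =>
    rw [Finset.sum_Ioc_succ_top (Nat.zero_le N), Finset.sum_Ioc_succ_top (Nat.zero_le N),
      Finset.sum_Ioc_succ_top (Nat.zero_le N), ih, Finset.sum_Ioc_succ_top (Nat.zero_le N)]
    push_cast
    field_simp
    ring

lemma sum_inv_mul_succ_le (N : ℕ) : ∑ n ∈ Ioc 0 N, (1 : ℝ) / (n * (n + 1)) ≤ 1 := by
  have : ∑ n ∈ Ioc 0 N, (1 : ℝ) / (n * (n + 1)) = 1 - 1 / (N + 1) := by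
    induction N with
    | zero => simp
    | succ N ih =>
      rw [Finset.sum_Ioc_succ_top (Nat.zero_le N), ih]
      push_cast
      field_simp
      ring
  rw [this]
  have : (0 : ℝ) ≤ 1 / (N + 1) := by positivity
  linarith

lemma sum_inv_eq_harmonic (N : ℕ) : ∑ n ∈ Ioc 0 N, (1 : ℝ) / n = harmonic N := by
  rw [harmonic_eq_sum_Icc]
  push_cast
  exact Finset.sum_congr rfl fun n _ => one_div _

lemma abs_sum_inv_sub_log_le {N : ℕ} (hN : 0 < N) : |∑ n ∈ Ioc 0 N, (1 : ℝ) / n - log N| ≤ 1 := by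
  rw [sum_inv_eq_harmonic, abs_le]
  have h1 := harmonic_le_one_add_log N
  have h2 := log_add_one_le_harmonic N
  have h3 : log N ≤ log ((N + 1 : ℕ) : ℝ) :=
    log_le_log (by exact_mod_cast hN) (by push_cast; linarith)
  constructor <;> linarith

lemma abs_sum_div_sub_mul_log_le {g : ℕ → ℝ} {α : ℝ}
    (h : Tendsto (fun N : ℕ => (∑ n ∈ Ioc 0 N, g n) / (N : ℝ)) atTop (𝓝 α)) {δ : ℝ} (hδ : 0 < δ) :
    ∃ C, 0 ≤ C ∧ ∀ N : ℕ, 0 < N → |∑ n ∈ Ioc 0 N, g n / n - α * log N| ≤ δ * log N + C := by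
  obtain ⟨C, hC0, hC⟩ := abs_sum_sub_mul_le h hδ
  refine ⟨2 * δ + 2 * C + |α|, by positivity, fun N hN => ?_⟩
  have hE : ∀ n : ℕ, ∑ m ∈ Ioc 0 n, (g m - α) = ∑ m ∈ Ioc 0 n, g m - α * n := fun n => by
    rw [Finset.sum_sub_distrib, Finset.sum_const, Nat.card_Ioc, nsmul_eq_mul, Nat.sub_zero,
      mul_comm]
  have h1 : ∑ n ∈ Ioc 0 N, g n / n - α * log N =
      ∑ n ∈ Ioc 0 N, (g n - α) / n + α * (∑ n ∈ Ioc 0 N, (1 : ℝ) / n - log N) := by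
    rw [mul_sub, Finset.mul_sum, ← add_sub_assoc, ← Finset.sum_add_distrib]
    congr 1
    exact Finset.sum_congr rfl fun n _ => by ring
  have hH := abs_sum_inv_sub_log_le hN
  have h2 : |(∑ n ∈ Ioc 0 N, (g n - α)) / ((N : ℝ) + 1)| ≤ δ + C := by
    rw [hE, abs_div, abs_of_pos (by positivity : (0 : ℝ) < N + 1), div_le_iff₀ (by positivity)]
    have hN0 : (0 : ℝ) ≤ C * N := by positivity
    linarith [hC N]
  have h3 : |∑ n ∈ Ioc 0 N, (∑ m ∈ Ioc 0 n, (g m - α)) / ((n : ℝ) * (n + 1))| ≤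
      δ * (1 + log N) + C := by
    refine (Finset.abs_sum_le_sum_abs _ _).trans ?_
    calc ∑ n ∈ Ioc 0 N, |(∑ m ∈ Ioc 0 n, (g m - α)) / ((n : ℝ) * (n + 1))|
        ≤ ∑ n ∈ Ioc 0 N, (δ * (1 / n) + C * (1 / (n * (n + 1)))) := by
          refine Finset.sum_le_sum fun n hn => ?_
          have hn0 : (0 : ℝ) < n := by exact_mod_cast (Finset.mem_Ioc.1 hn).1
          rw [hE, abs_div, abs_of_pos (by positivity : (0 : ℝ) < n * (n + 1)),
            div_le_iff₀ (by positivity)]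
          have : (δ * (1 / n) + C * (1 / (n * (n + 1)))) * ((n : ℝ) * (n + 1)) =
              δ * n + C + δ := by field_simp; ring
          rw [this]
          linarith [hC n]
      _ ≤ δ * (1 + log N) + C := by
          rw [Finset.sum_add_distrib, ← Finset.mul_sum, ← Finset.mul_sum]
          have := sum_inv_mul_succ_le N
          have h4 : ∑ n ∈ Ioc 0 N, (1 : ℝ) / n ≤ 1 + log N := by linarith [(abs_le.1 hH).2]
          have h5 := mul_le_mul_of_nonneg_left h4 hδ.le
          have h6 := mul_le_mul_of_nonneg_left this hC0
          linarith
  have h4 : |α * (∑ n ∈ Ioc 0 N, (1 : ℝ) / n - log N)| ≤ |α| := by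
    rw [abs_mul]
    exact mul_le_of_le_one_right (abs_nonneg α) hH
  rw [h1, sum_div_eq_sum_partial_sums]
  refine (abs_add_le _ _).trans ((add_le_add (abs_add_le _ _) le_rfl).trans ?_)
  linarith

end PartialSummation

section LogarithmicScale

variable {g : ℕ → ℝ} {α : ℝ}

lemma floor_exp_le (u : ℝ) : (⌊exp u⌋₊ : ℝ) ≤ exp u := Nat.floor_le (exp_pos u).le

lemma floor_exp_pos {u : ℝ} (hu : 0 ≤ u) : 0 < ⌊exp u⌋₊ :=
  Nat.floor_pos.2 (one_le_exp hu)

lemma abs_expSum_sub_mul_exp_le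
    (h : Tendsto (fun N : ℕ => (∑ n ∈ Ioc 0 N, g n) / (N : ℝ)) atTop (𝓝 α)) {δ : ℝ} (hδ : 0 < δ) :
    ∃ C, 0 ≤ C ∧ ∀ v, |expSum g v - α * exp v| ≤ δ * exp v + C := by
  obtain ⟨C, hC0, hC⟩ := abs_sum_sub_mul_le h hδ
  refine ⟨C + |α|, by positivity, fun v => ?_⟩
  have h1 := floor_exp_le v
  have h2 := (Nat.lt_floor_add_one (exp v)).le
  have h3 : |α * (⌊exp v⌋₊ - exp v)| ≤ |α| := by
    rw [abs_mul]
    refine mul_le_of_le_one_right (abs_nonneg α) (abs_le.2 ⟨?_, ?_⟩) <;> linarith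
  have h4 := mul_le_mul_of_nonneg_left h1 hδ.le
  calc |expSum g v - α * exp v| =
        |(expSum g v - α * ⌊exp v⌋₊) + α * (⌊exp v⌋₊ - exp v)| := by ring_nf
    _ ≤ |expSum g v - α * ⌊exp v⌋₊| + |α * (⌊exp v⌋₊ - exp v)| := abs_add_le _ _
    _ ≤ δ * exp v + (C + |α|) := by
        have := hC ⌊exp v⌋₊
        rw [expSum]
        linarith

lemma abs_expSum_div_sub_mul_le
    (h : Tendsto (fun N : ℕ => (∑ n ∈ Ioc 0 N, g n) / (N : ℝ)) atTop (𝓝 α)) {δ : ℝ} (hδ : 0 < δ) :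
    ∃ C, 0 ≤ C ∧ ∀ v, 0 ≤ v → |expSum (fun n => g n / n) v - α * v| ≤ δ * v + C := by
  obtain ⟨C, hC0, hC⟩ := abs_sum_div_sub_mul_log_le h hδ
  refine ⟨C + |α|, by positivity, fun v hv => ?_⟩
  have hN := floor_exp_pos hv
  have hN1 : (1 : ℝ) ≤ ⌊exp v⌋₊ := by exact_mod_cast hN
  have h1 : log ⌊exp v⌋₊ ≤ v := (log_le_iff_le_exp (by linarith)).2 (floor_exp_le v)
  have h2 : v ≤ log ⌊exp v⌋₊ + 1 := by
    rw [← log_exp 1, ← log_mul (by positivity) (by positivity), le_log_iff_exp_le (by positivity)]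
    have := (Nat.lt_floor_add_one (exp v)).le
    have he : (2 : ℝ) ≤ exp 1 := by linarith [add_one_le_exp (1 : ℝ)]
    nlinarith
  have h3 : |α * (log ⌊exp v⌋₊ - v)| ≤ |α| := by
    rw [abs_mul]
    refine mul_le_of_le_one_right (abs_nonneg α) (abs_le.2 ⟨?_, ?_⟩) <;> linarith
  have h4 := mul_le_mul_of_nonneg_left h1 hδ.le
  calc |expSum (fun n => g n / n) v - α * v| =
        |(expSum (fun n => g n / n) v - α * log ⌊exp v⌋₊) + α * (log ⌊exp v⌋₊ - v)| := by ring_nf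
    _ ≤ |expSum (fun n => g n / n) v - α * log ⌊exp v⌋₊| + |α * (log ⌊exp v⌋₊ - v)| :=
        abs_add_le _ _
    _ ≤ δ * v + (C + |α|) := by
        have := hC ⌊exp v⌋₊ hN
        rw [expSum]
        linarith

lemma tendsto_expSum_div_div
    (h : Tendsto (fun N : ℕ => (∑ n ∈ Ioc 0 N, g n) / (N : ℝ)) atTop (𝓝 α)) :
    Tendsto (fun u => expSum (fun n => g n / n) u / u) atTop (𝓝 α) := by
  refine Metric.tendsto_nhds.2 fun ε hε => ?_
  obtain ⟨C, hC0, hC⟩ := abs_expSum_div_sub_mul_le h (half_pos hε)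
  filter_upwards [eventually_gt_atTop 0, eventually_gt_atTop (2 * C / ε)] with u hu hu'
  rw [dist_eq_norm, Real.norm_eq_abs, div_sub' hu.ne', abs_div, abs_of_pos hu, div_lt_iff₀ hu,
    mul_comm u]
  rw [div_lt_iff₀ hε] at hu'
  linarith [hC u hu.le]

lemma expSum_conv (f g : ℕ → ℝ) (u : ℝ) :
    expSum (conv f g) u = ∑ m ∈ Ioc 0 ⌊exp u⌋₊, f m * expSum g (u - log m) := by
  rw [expSum, sum_conv]
  refine Finset.sum_congr rfl fun m hm => ?_
  rw [expSum, exp_sub, exp_log (by exact_mod_cast (Finset.mem_Ioc.1 hm).1), Nat.floor_div_natCast]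

lemma expSum_le_mul_exp {h : ℕ → ℝ} (hh : ∀ n, 0 ≤ h n) (hs : Summable fun n : ℕ => h n / n)
    {δ : ℝ} (hδ : 0 < δ) : ∃ C, 0 ≤ C ∧ ∀ v, expSum h v ≤ δ * exp v + C := by
  obtain ⟨s, hs⟩ := summable_iff_vanishing_norm.1 hs δ hδ
  refine ⟨∑ n ∈ s, h n, Finset.sum_nonneg fun _ _ => hh _, fun v => ?_⟩
  rw [expSum, ← Finset.sum_inter_add_sum_sdiff (Ioc 0 ⌊exp v⌋₊) s, add_comm]
  refine add_le_add ?_ (Finset.sum_le_sum_of_subset_of_nonneg Finset.inter_subset_right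
    fun _ _ _ => hh _)
  have h1 := (le_abs_self _).trans (hs (Ioc 0 ⌊exp v⌋₊ \ s) Finset.sdiff_disjoint).le
  rw [mul_comm]
  refine le_trans ?_ (mul_le_mul_of_nonneg_left h1 (exp_pos v).le)
  rw [Finset.mul_sum]
  refine Finset.sum_le_sum fun n hn => ?_
  have hn' := Finset.mem_Ioc.1 (Finset.mem_sdiff.1 hn).1
  have hn0 : (0 : ℝ) < n := by exact_mod_cast hn'.1
  have hnv : (n : ℝ) ≤ exp v := (Nat.le_floor_iff (exp_pos v).le).1 hn'.2
  rw [mul_div_assoc', le_div_iff₀ hn0, mul_comm]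
  exact mul_le_mul_of_nonneg_right hnv (hh n)

lemma le_mul_exp_add {δ : ℝ} (hδ : 0 < δ) (v : ℝ) : v ≤ δ * exp v + |log δ| := by
  have h1 := add_one_le_exp (log δ + v)
  rw [exp_add, exp_log hδ] at h1
  linarith [neg_abs_le (log δ)]

end LogarithmicScale

section Multiplicative

variable {ω : ℕ → ℝ} {α : ℝ}

lemma expSum_mul_log (c : ℕ → ℝ) (u : ℝ) :
    expSum (fun n => c n * log n) u = u * expSum c u - expSumInt c u := by
  rw [expSum, expSum, expSumInt, Finset.mul_sum, ← Finset.sum_sub_distrib]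
  exact Finset.sum_congr rfl fun n _ => by ring

lemma abs_expSum_mul_log_sub_le {c g h : ℕ → ℝ}
    (hd : ∀ n ≠ 0, |c n * log n - conv c g n| ≤ conv c h n) (u : ℝ) :
    |expSum (fun n => c n * log n) u - ∑ m ∈ Ioc 0 ⌊exp u⌋₊, c m * expSum g (u - log m)| ≤
      ∑ m ∈ Ioc 0 ⌊exp u⌋₊, c m * expSum h (u - log m) := by
  rw [← expSum_conv, ← expSum_conv, expSum, expSum, expSum, ← Finset.sum_sub_distrib]
  exact (Finset.abs_sum_le_sum_abs _ _).trans
    (Finset.sum_le_sum fun n hn => hd n (Finset.mem_Ioc.1 hn).1.ne')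

lemma abs_div_mul_log_sub_conv_le (hnn : ∀ n, 0 ≤ ω n)
    (hmult : ∀ m n : ℕ, Nat.Coprime m n → ω (m * n) = ω m * ω n) {n : ℕ} (hn : n ≠ 0) :
    |ω n / n * log n - conv (fun n => ω n / n) (fun n => primeLog ω n / n) n| ≤
      conv (fun n => ω n / n) (fun n => correction ω n / n) n := by
  rw [conv_div, conv_div, div_mul_eq_mul_div, ← sub_div, abs_div, Nat.abs_cast]
  exact div_le_div_of_nonneg_right (abs_mul_log_sub_conv_le hnn hmult hn) (Nat.cast_nonneg n)

lemma eulerRelation_div (hnn : ∀ n, 0 ≤ ω n)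
    (hmult : ∀ m n : ℕ, Nat.Coprime m n → ω (m * n) = ω m * ω n)
    (hg : Tendsto (fun N : ℕ => (∑ n ∈ Ioc 0 N, primeLog ω n) / (N : ℝ)) atTop (𝓝 α))
    (hs : Summable fun n : ℕ => correction ω n / n) :
    EulerRelation (fun n => ω n / n) (α + 1) := by
  intro δ hδ
  obtain ⟨C, hC0, hC⟩ := abs_expSum_div_sub_mul_le hg hδ
  have hc : ∀ n : ℕ, 0 ≤ ω n / n := fun n => div_nonneg (hnn n) (Nat.cast_nonneg n)
  refine ⟨C + ∑' n : ℕ, correction ω n / n, fun u hu => ?_⟩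
  have h1 := abs_expSum_mul_log_sub_le
    (fun n hn => abs_div_mul_log_sub_conv_le hnn hmult hn) u
  have h2 : ∑ m ∈ Ioc 0 ⌊exp u⌋₊, ω m / m * expSum (fun n => correction ω n / n) (u - log m) ≤
      (∑' n : ℕ, correction ω n / n) * expSum (fun n => ω n / n) u := by
    rw [mul_comm, expSum, Finset.sum_mul]
    refine Finset.sum_le_sum fun m _ => mul_le_mul_of_nonneg_left ?_ (hc m)
    exact hs.sum_le_tsum _ fun n _ => div_nonneg (correction_nonneg hnn n) (Nat.cast_nonneg n)
  have h3 : |∑ m ∈ Ioc 0 ⌊exp u⌋₊, ω m / m * expSum (fun n => primeLog ω n / n) (u - log m) -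
      α * expSumInt (fun n => ω n / n) u| ≤ (δ * u + C) * expSum (fun n => ω n / n) u := by
    rw [expSumInt, Finset.mul_sum, ← Finset.sum_sub_distrib, mul_comm, expSum, Finset.sum_mul]
    refine (Finset.abs_sum_le_sum_abs _ _).trans (Finset.sum_le_sum fun m hm => ?_)
    have hm' := mem_Ioc_floor_exp.1 hm
    have hlog : 0 ≤ log m := log_natCast_nonneg m
    rw [mul_left_comm, ← mul_sub, abs_mul, abs_of_nonneg (hc m)]
    refine mul_le_mul_of_nonneg_left ((hC _ (sub_nonneg.2 hm'.2)).trans ?_) (hc m)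
    nlinarith
  rw [expSum_mul_log] at h1
  rw [abs_le] at h1 h3 ⊢
  constructor <;> nlinarith

lemma tendsto_mul_expSum_div (hnn : ∀ n, 0 ≤ ω n) (hω1 : ω 1 = 1)
    (hmult : ∀ m n : ℕ, Nat.Coprime m n → ω (m * n) = ω m * ω n)
    (hg : Tendsto (fun N : ℕ => (∑ n ∈ Ioc 0 N, primeLog ω n) / (N : ℝ)) atTop (𝓝 α))
    (hs : Summable fun n : ℕ => correction ω n / n) :
    Tendsto (fun u => u * expSum ω u / (exp u * expSum (fun n => ω n / n) u)) atTop (𝓝 α) := by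
  have hc : ∀ n : ℕ, 0 ≤ ω n / n := fun n => div_nonneg (hnn n) (Nat.cast_nonneg n)
  have key : ∀ δ : ℝ, 0 < δ → ∃ C, 0 ≤ C ∧ ∀ u, |u * expSum ω u -
      α * (exp u * expSum (fun n => ω n / n) u)| ≤
      δ * (exp u * expSum (fun n => ω n / n) u) + C * expSum ω u := by
    intro δ hδ
    have hδ3 : 0 < δ / 3 := by positivity
    obtain ⟨C₁, hC₁0, hC₁⟩ := abs_expSum_sub_mul_exp_le hg hδ3
    obtain ⟨C₂, hC₂0, hC₂⟩ := expSum_le_mul_exp (correction_nonneg hnn) hs hδ3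
    refine ⟨C₁ + C₂ + |log (δ / 3)|, by positivity, fun u => ?_⟩
    have hexp : exp u * expSum (fun n => ω n / n) u =
        ∑ m ∈ Ioc 0 ⌊exp u⌋₊, ω m * exp (u - log m) := by
      rw [expSum, Finset.mul_sum]
      refine Finset.sum_congr rfl fun m hm => ?_
      rw [exp_sub, exp_log (by exact_mod_cast (Finset.mem_Ioc.1 hm).1)]
      ring
    have h1 := abs_expSum_mul_log_sub_le (fun n hn => abs_mul_log_sub_conv_le hnn hmult hn) u
    have h2 : |∑ m ∈ Ioc 0 ⌊exp u⌋₊, ω m * expSum (primeLog ω) (u - log m) -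
        α * (exp u * expSum (fun n => ω n / n) u)| ≤
        δ / 3 * (exp u * expSum (fun n => ω n / n) u) + C₁ * expSum ω u := by
      rw [hexp, expSum, Finset.mul_sum, Finset.mul_sum, Finset.mul_sum,
        ← Finset.sum_sub_distrib, ← Finset.sum_add_distrib]
      refine (Finset.abs_sum_le_sum_abs _ _).trans (Finset.sum_le_sum fun m _ => ?_)
      rw [mul_left_comm, ← mul_sub, abs_mul, abs_of_nonneg (hnn m)]
      linarith [mul_le_mul_of_nonneg_left (hC₁ (u - log m)) (hnn m)]
    have h3 : ∑ m ∈ Ioc 0 ⌊exp u⌋₊, ω m * expSum (correction ω) (u - log m) ≤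
        δ / 3 * (exp u * expSum (fun n => ω n / n) u) + C₂ * expSum ω u := by
      rw [hexp, expSum, Finset.mul_sum, Finset.mul_sum, ← Finset.sum_add_distrib]
      refine Finset.sum_le_sum fun m _ => ?_
      linarith [mul_le_mul_of_nonneg_left (hC₂ (u - log m)) (hnn m)]
    have h4 : expSumInt ω u ≤
        δ / 3 * (exp u * expSum (fun n => ω n / n) u) + |log (δ / 3)| * expSum ω u := by
      rw [hexp, expSum, expSumInt, Finset.mul_sum, Finset.mul_sum, ← Finset.sum_add_distrib]
      refine Finset.sum_le_sum fun m _ => ?_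
      linarith [mul_le_mul_of_nonneg_left (le_mul_exp_add hδ3 (u - log m)) (hnn m)]
    have h5 : 0 ≤ expSumInt ω u := Finset.sum_nonneg fun m hm =>
      mul_nonneg (hnn m) (sub_nonneg.2 (mem_Ioc_floor_exp.1 hm).2)
    rw [expSum_mul_log] at h1
    rw [abs_le] at h1 h2 ⊢
    constructor <;> linarith
  refine Metric.tendsto_nhds.2 fun ε hε => ?_
  obtain ⟨C, hC0, hC⟩ := key (ε / 3) (by positivity)
  filter_upwards [eventually_gt_atTop 0, eventually_ge_atTop (2 * C),
    eventually_ge_atTop (3 * C * (2 * (α + ε / 3)) / ε)] with u hu hu1 hu2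
  have hM : 0 < exp u * expSum (fun n => ω n / n) u :=
    mul_pos (exp_pos u) (expSum_pos hc (by simp [hω1]) hu.le)
  have hS : 0 ≤ expSum ω u := expSum_nonneg hnn u
  have h := hC u
  set M := exp u * expSum (fun n => ω n / n) u
  set S := expSum ω u
  rw [dist_eq_norm, Real.norm_eq_abs, div_sub' hM.ne', abs_div, abs_of_pos hM, div_lt_iff₀ hM,
    mul_comm M]
  refine h.trans_lt ?_
  rw [div_le_iff₀ hε] at hu2
  have h1 : u * S ≤ 2 * (α + ε / 3) * M := by
    have := (abs_le.1 h).2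
    nlinarith
  have h2 : u * (C * S) ≤ u * (ε / 3 * M) := by
    calc u * (C * S) = C * (u * S) := by ring
      _ ≤ C * (2 * (α + ε / 3) * M) := mul_le_mul_of_nonneg_left h1 hC0
      _ = (3 * C * (2 * (α + ε / 3))) * (M / 3) := by ring
      _ ≤ u * ε * (M / 3) := mul_le_mul_of_nonneg_right hu2 (by positivity)
      _ = u * (ε / 3 * M) := by ring
  have h3 := le_of_mul_le_mul_left h2 hu
  have : 0 < ε * M := by positivity
  linarith

end Multiplicative

section EulerFactors

variable {ω : ℕ → ℝ} {γ₁ γ₂ : ℝ}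

/-- The Euler factor at `p` of the Dirichlet series of `ω`, evaluated at `1 + s`. -/
noncomputable def eulerFactor (ω : ℕ → ℝ) (s : ℝ) (p : ℕ) : ℝ :=
  ∑' k : ℕ, ω (p ^ k) / (p : ℝ) ^ k * exp (-(s * (k * log p)))

/-- The logarithm of the Euler factor at a prime, minus its leading term. -/
noncomputable def logRemainder (ω : ℕ → ℝ) (s : ℝ) (n : ℕ) : ℝ :=
  if n.Prime then log (eulerFactor ω s n) - ω n / n * exp (-(s * log n)) else 0

lemma eulerTerm_nonneg (hnn : ∀ n, 0 ≤ ω n) (s : ℝ) (p k : ℕ) :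
    0 ≤ ω (p ^ k) / (p : ℝ) ^ k * exp (-(s * (k * log p))) :=
  mul_nonneg (div_nonneg (hnn _) (by positivity)) (exp_pos _).le

lemma eulerTerm_le (hγ₁ : 0 < γ₁) (hγ₂0 : 0 < γ₂)
    (hpp : ∀ p k : ℕ, Nat.Prime p → 1 ≤ k → ω (p ^ k) ≤ γ₁ * γ₂ ^ k) {s : ℝ} (hs : 0 ≤ s)
    {p k : ℕ} (hp : p.Prime) (hk : 1 ≤ k) :
    ω (p ^ k) / (p : ℝ) ^ k * exp (-(s * (k * log p))) ≤ γ₁ * (γ₂ / p) ^ k := by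
  have h0 : 0 ≤ s * (k * log p) := by positivity
  have hp0 : (0 : ℝ) < p := by exact_mod_cast hp.pos
  calc _ ≤ γ₁ * γ₂ ^ k / (p : ℝ) ^ k * 1 := by
        gcongr
        · exact hpp p k hp hk
        · exact exp_le_one_iff.2 (by linarith)
    _ = γ₁ * (γ₂ / p) ^ k := by rw [div_pow]; ring

lemma summable_geometric_div_prime (hγ₂0 : 0 < γ₂) (hγ₂2 : γ₂ < 2) {p : ℕ} (hp : p.Prime) (C : ℝ) :
    Summable fun k : ℕ => C * (γ₂ / p) ^ k := by
  have hp2 : (2 : ℝ) ≤ p := by exact_mod_cast hp.two_le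
  refine (summable_geometric_of_lt_one (by positivity) ?_).mul_left C
  rw [div_lt_one (by linarith)]
  linarith

lemma eulerTerm_le_of_one (hω1 : ω 1 = 1) (hγ₁ : 0 < γ₁) (hγ₂0 : 0 < γ₂)
    (hpp : ∀ p k : ℕ, Nat.Prime p → 1 ≤ k → ω (p ^ k) ≤ γ₁ * γ₂ ^ k) {s : ℝ} (hs : 0 ≤ s)
    {p : ℕ} (hp : p.Prime) (k : ℕ) :
    ω (p ^ k) / (p : ℝ) ^ k * exp (-(s * (k * log p))) ≤ (γ₁ + 1) * (γ₂ / p) ^ k := by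
  rcases Nat.eq_zero_or_pos k with rfl | hk
  · simp [hω1, hγ₁.le]
  · refine (eulerTerm_le hγ₁ hγ₂0 hpp hs hp hk).trans ?_
    gcongr
    linarith

lemma summable_eulerTerm (hnn : ∀ n, 0 ≤ ω n) (hω1 : ω 1 = 1) (hγ₁ : 0 < γ₁) (hγ₂0 : 0 < γ₂)
    (hγ₂2 : γ₂ < 2) (hpp : ∀ p k : ℕ, Nat.Prime p → 1 ≤ k → ω (p ^ k) ≤ γ₁ * γ₂ ^ k)
    {s : ℝ} (hs : 0 ≤ s) {p : ℕ} (hp : p.Prime) :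
    Summable fun k : ℕ => ω (p ^ k) / (p : ℝ) ^ k * exp (-(s * (k * log p))) :=
  Summable.of_nonneg_of_le (eulerTerm_nonneg hnn s p)
    (eulerTerm_le_of_one hω1 hγ₁ hγ₂0 hpp hs hp) (summable_geometric_div_prime hγ₂0 hγ₂2 hp _)

lemma one_le_eulerFactor (hnn : ∀ n, 0 ≤ ω n) (hω1 : ω 1 = 1) (hγ₁ : 0 < γ₁) (hγ₂0 : 0 < γ₂)
    (hγ₂2 : γ₂ < 2) (hpp : ∀ p k : ℕ, Nat.Prime p → 1 ≤ k → ω (p ^ k) ≤ γ₁ * γ₂ ^ k)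
    {s : ℝ} (hs : 0 ≤ s) {p : ℕ} (hp : p.Prime) : 1 ≤ eulerFactor ω s p := by
  have := (summable_eulerTerm hnn hω1 hγ₁ hγ₂0 hγ₂2 hpp hs hp).le_tsum 0
    fun k _ => eulerTerm_nonneg hnn s p k
  refine le_trans (by simp [hω1]) this

lemma eulerFactor_eq (hnn : ∀ n, 0 ≤ ω n) (hω1 : ω 1 = 1) (hγ₁ : 0 < γ₁) (hγ₂0 : 0 < γ₂)
    (hγ₂2 : γ₂ < 2) (hpp : ∀ p k : ℕ, Nat.Prime p → 1 ≤ k → ω (p ^ k) ≤ γ₁ * γ₂ ^ k)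
    {s : ℝ} (hs : 0 ≤ s) {p : ℕ} (hp : p.Prime) :
    ∃ y, 0 ≤ y ∧ y ≤ γ₁ * γ₂ ^ 2 * (1 - γ₂ / 2)⁻¹ / (p : ℝ) ^ 2 ∧
      eulerFactor ω s p = 1 + ω p / p * exp (-(s * log p)) + y := by
  have hp2 : (2 : ℝ) ≤ p := by exact_mod_cast hp.two_le
  have hsum := summable_eulerTerm hnn hω1 hγ₁ hγ₂0 hγ₂2 hpp hs hp
  refine ⟨∑' k : ℕ, ω (p ^ (k + 2)) / (p : ℝ) ^ (k + 2) * exp (-(s * ((k + 2 : ℕ) * log p))),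
    tsum_nonneg fun k => eulerTerm_nonneg hnn s p (k + 2), ?_, ?_⟩
  · have hgeo := (hasSum_geometric_of_lt_one (r := γ₂ / 2) (by positivity) (by linarith)).mul_left
      (γ₁ * γ₂ ^ 2 / (p : ℝ) ^ 2)
    refine (((summable_nat_add_iff 2).2 hsum).tsum_le_tsum (fun k => ?_) hgeo.summable).trans_eq
      (hgeo.tsum_eq.trans (by ring))
    calc _ ≤ γ₁ * (γ₂ / p) ^ (k + 2) := eulerTerm_le hγ₁ hγ₂0 hpp hs hp (by omega)
      _ = γ₁ * γ₂ ^ 2 / (p : ℝ) ^ 2 * (γ₂ / p) ^ k := by rw [pow_add, div_pow γ₂ _ 2]; ring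
      _ ≤ _ := by gcongr
  · rw [eulerFactor, ← hsum.sum_add_tsum_nat_add 2, Finset.sum_range_succ, Finset.sum_range_one]
    simp [hω1]

lemma abs_logRemainder_le (hnn : ∀ n, 0 ≤ ω n) (hω1 : ω 1 = 1) (hγ₁ : 0 < γ₁) (hγ₂0 : 0 < γ₂)
    (hγ₂2 : γ₂ < 2) (hpp : ∀ p k : ℕ, Nat.Prime p → 1 ≤ k → ω (p ^ k) ≤ γ₁ * γ₂ ^ k)
    {s : ℝ} (hs : 0 ≤ s) (n : ℕ) :
    |logRemainder ω s n| ≤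
      (γ₁ * γ₂ ^ 2 * (1 - γ₂ / 2)⁻¹ + (γ₁ * γ₂) ^ 2) * (1 / (n : ℝ) ^ 2) := by
  have hinv : 0 < (1 - γ₂ / 2)⁻¹ := inv_pos.2 (by linarith)
  rw [logRemainder]
  split_ifs with hp
  swap
  · rw [abs_zero]; positivity
  obtain ⟨y, hy0, hy, he⟩ := eulerFactor_eq hnn hω1 hγ₁ hγ₂0 hγ₂2 hpp hs hp
  have hz := eulerTerm_le hγ₁ hγ₂0 hpp hs hp le_rfl
  have hz0 := eulerTerm_nonneg hnn s n 1
  simp only [pow_one, Nat.cast_one, one_mul] at hz hz0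
  rw [he]
  set z := ω n / n * exp (-(s * log n))
  have hup := log_le_sub_one_of_pos (show 0 < 1 + z + y by linarith)
  have hlow : z - z ^ 2 ≤ log (1 + z + y) := by
    refine le_trans ?_ (one_sub_inv_le_log_of_pos (show 0 < 1 + z + y by linarith))
    have h1 : (1 + z + y)⁻¹ ≤ (1 + z)⁻¹ := inv_anti₀ (by linarith) (by linarith)
    have h2 : (1 + z)⁻¹ ≤ 1 - z + z ^ 2 := by
      rw [inv_le_iff_one_le_mul₀ (by linarith)]
      nlinarith [pow_nonneg hz0 3]
    linarith
  have hz2 : z ^ 2 ≤ (γ₁ * γ₂) ^ 2 * (1 / (n : ℝ) ^ 2) := by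
    calc z ^ 2 ≤ (γ₁ * (γ₂ / n)) ^ 2 := pow_le_pow_left₀ hz0 hz 2
      _ = _ := by ring
  have hz2' : 0 ≤ z ^ 2 := sq_nonneg z
  rw [div_eq_mul_one_div] at hy
  rw [abs_le, add_mul]
  constructor <;> linarith

lemma tendsto_eulerFactor (hnn : ∀ n, 0 ≤ ω n) (hω1 : ω 1 = 1) (hγ₁ : 0 < γ₁) (hγ₂0 : 0 < γ₂)
    (hγ₂2 : γ₂ < 2) (hpp : ∀ p k : ℕ, Nat.Prime p → 1 ≤ k → ω (p ^ k) ≤ γ₁ * γ₂ ^ k)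
    {p : ℕ} (hp : p.Prime) :
    Tendsto (fun u => eulerFactor ω u⁻¹ p) atTop (𝓝 (eulerFactor ω 0 p)) := by
  refine tendsto_tsum_of_dominated_convergence
    (summable_geometric_div_prime hγ₂0 hγ₂2 hp (γ₁ + 1)) (fun k => ?_) ?_
  · refine Tendsto.const_mul _ ((continuous_exp.tendsto _).comp ?_)
    exact (tendsto_inv_atTop_zero.mul_const _).neg
  · filter_upwards [eventually_ge_atTop 0] with u hu k
    rw [norm_of_nonneg (eulerTerm_nonneg hnn _ _ _)]
    exact eulerTerm_le_of_one hω1 hγ₁ hγ₂0 hpp (inv_nonneg.2 hu) hp k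

lemma summable_logRemainder (hnn : ∀ n, 0 ≤ ω n) (hω1 : ω 1 = 1) (hγ₁ : 0 < γ₁) (hγ₂0 : 0 < γ₂)
    (hγ₂2 : γ₂ < 2) (hpp : ∀ p k : ℕ, Nat.Prime p → 1 ≤ k → ω (p ^ k) ≤ γ₁ * γ₂ ^ k)
    {s : ℝ} (hs : 0 ≤ s) : Summable (logRemainder ω s) :=
  Summable.of_norm_bounded ((summable_one_div_nat_pow.2 one_lt_two).mul_left _)
    (abs_logRemainder_le hnn hω1 hγ₁ hγ₂0 hγ₂2 hpp hs)

lemma tendsto_tsum_logRemainder (hnn : ∀ n, 0 ≤ ω n) (hω1 : ω 1 = 1) (hγ₁ : 0 < γ₁)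
    (hγ₂0 : 0 < γ₂) (hγ₂2 : γ₂ < 2)
    (hpp : ∀ p k : ℕ, Nat.Prime p → 1 ≤ k → ω (p ^ k) ≤ γ₁ * γ₂ ^ k) :
    Tendsto (fun u => ∑' n, logRemainder ω u⁻¹ n) atTop (𝓝 (∑' n, logRemainder ω 0 n)) := by
  refine tendsto_tsum_of_dominated_convergence
    ((summable_one_div_nat_pow.2 one_lt_two).mul_left
      (γ₁ * γ₂ ^ 2 * (1 - γ₂ / 2)⁻¹ + (γ₁ * γ₂) ^ 2)) (fun n => ?_) ?_
  · simp only [logRemainder]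
    split_ifs with hp
    · refine Tendsto.sub ((tendsto_eulerFactor hnn hω1 hγ₁ hγ₂0 hγ₂2 hpp hp).log
        (zero_lt_one.trans_le (one_le_eulerFactor hnn hω1 hγ₁ hγ₂0 hγ₂2 hpp le_rfl hp)).ne') ?_
      refine Tendsto.const_mul _ ((continuous_exp.tendsto _).comp ?_)
      exact (tendsto_inv_atTop_zero.mul_const _).neg
    · exact tendsto_const_nhds
  · filter_upwards [eventually_ge_atTop 0] with u hu n
    exact abs_logRemainder_le hnn hω1 hγ₁ hγ₂0 hγ₂2 hpp (inv_nonneg.2 hu) n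

lemma primeLog_div_div_log (n : ℕ) :
    primeLog ω n / n / log n = if n.Prime then ω n / n else 0 := by
  rw [primeLog]
  split_ifs with hp
  · have : log n ≠ 0 := (log_pos (by exact_mod_cast hp.one_lt)).ne'
    field_simp
  · simp

lemma log_prod_eulerFactor (hnn : ∀ n, 0 ≤ ω n) (hω1 : ω 1 = 1) (hγ₁ : 0 < γ₁) (hγ₂0 : 0 < γ₂)
    (hγ₂2 : γ₂ < 2) (hpp : ∀ p k : ℕ, Nat.Prime p → 1 ≤ k → ω (p ^ k) ≤ γ₁ * γ₂ ^ k)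
    {s : ℝ} (hs : 0 ≤ s) (N : ℕ) :
    log (∏ p ∈ N.primesBelow, eulerFactor ω s p) =
      ∑ n ∈ range N, primeLog ω n / n / log n * exp (-(s * log n)) +
        ∑ n ∈ range N, logRemainder ω s n := by
  rw [log_prod fun p hp => (zero_lt_one.trans_le (one_le_eulerFactor hnn hω1 hγ₁ hγ₂0 hγ₂2 hpp hs
      (Nat.prime_of_mem_primesBelow hp))).ne', Nat.primesBelow, Finset.sum_filter,
    ← Finset.sum_add_distrib]
  refine Finset.sum_congr rfl fun n _ => ?_
  rw [primeLog_div_div_log, logRemainder]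
  split_ifs <;> ring

lemma tendsto_prod_eulerFactor (hω1 : ω 1 = 1)
    (hmult : ∀ m n : ℕ, Nat.Coprime m n → ω (m * n) = ω m * ω n) {s : ℝ}
    (hs : Summable fun n : ℕ => ω n / n * exp (-(s * log n))) :
    Tendsto (fun N : ℕ => ∏ p ∈ N.primesBelow, eulerFactor ω s p) atTop
      (𝓝 (∑' n : ℕ, ω n / n * exp (-(s * log n)))) := by
  have h := EulerProduct.eulerProduct (f := fun n : ℕ => ω n / n * exp (-(s * log n)))
    (by simp [hω1]) (fun {m n} hmn => ?_) (by simpa only [norm_eq_abs] using hs.abs) (by simp)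
  · simpa only [eulerFactor, Nat.cast_pow, log_pow] using h
  · rcases eq_or_ne m 0 with rfl | hm
    · simp
    rcases eq_or_ne n 0 with rfl | hn
    · simp
    rw [hmult m n hmn, Nat.cast_mul, log_mul (by exact_mod_cast hm) (by exact_mod_cast hn),
      mul_add, neg_add, exp_add]
    ring

lemma log_tsum_eq (hnn : ∀ n, 0 ≤ ω n) (hω1 : ω 1 = 1)
    (hmult : ∀ m n : ℕ, Nat.Coprime m n → ω (m * n) = ω m * ω n) (hγ₁ : 0 < γ₁) (hγ₂0 : 0 < γ₂)
    (hγ₂2 : γ₂ < 2) (hpp : ∀ p k : ℕ, Nat.Prime p → 1 ≤ k → ω (p ^ k) ≤ γ₁ * γ₂ ^ k)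
    {s : ℝ} (hs : 0 ≤ s) (hF : Summable fun n : ℕ => ω n / n * exp (-(s * log n)))
    (hG : Summable fun n : ℕ => primeLog ω n / n / log n * exp (-(s * log n))) :
    0 < ∑' n : ℕ, ω n / n * exp (-(s * log n)) ∧
      log (∑' n : ℕ, ω n / n * exp (-(s * log n))) =
        ∑' n : ℕ, primeLog ω n / n / log n * exp (-(s * log n)) + ∑' n, logRemainder ω s n := by
  have hpos : 0 < ∑' n : ℕ, ω n / n * exp (-(s * log n)) :=
    hF.tsum_pos (fun n => mul_nonneg (div_nonneg (hnn n) (Nat.cast_nonneg n)) (exp_pos _).le) 1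
      (by simp [hω1])
  refine ⟨hpos, tendsto_nhds_unique
    ((tendsto_prod_eulerFactor hω1 hmult hF).log hpos.ne') ?_⟩
  simp only [log_prod_eulerFactor hnn hω1 hγ₁ hγ₂0 hγ₂2 hpp hs]
  exact hG.hasSum.tendsto_sum_nat.add
    (summable_logRemainder hnn hω1 hγ₁ hγ₂0 hγ₂2 hpp hs).hasSum.tendsto_sum_nat

end EulerFactors

section MeanValue

variable {ω : ℕ → ℝ} {α γ₁ γ₂ : ℝ}

lemma sum_primeLog_eq (N : ℕ) :
    ∑ n ∈ Ioc 0 N, primeLog ω n = ∑ p ∈ Finset.filter Nat.Prime (range (N + 1)), ω p * log p := by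
  simp only [primeLog]
  rw [← Finset.sum_filter]
  refine Finset.sum_congr ?_ fun _ _ => rfl
  ext p
  simp only [Finset.mem_filter, Finset.mem_Ioc, Finset.mem_range, Nat.lt_succ_iff]
  exact ⟨fun h => ⟨h.1.2, h.2⟩, fun h => ⟨⟨h.2.pos, h.1⟩, h.2⟩⟩

lemma tendsto_tsum_div_prod_eulerFactor (hnn : ∀ n, 0 ≤ ω n) (hω1 : ω 1 = 1)
    (hmult : ∀ m n : ℕ, Nat.Coprime m n → ω (m * n) = ω m * ω n) (hγ₁ : 0 < γ₁) (hγ₂0 : 0 < γ₂)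
    (hγ₂2 : γ₂ < 2) (hpp : ∀ p k : ℕ, Nat.Prime p → 1 ≤ k → ω (p ^ k) ≤ γ₁ * γ₂ ^ k)
    (hg : Tendsto (fun N : ℕ => (∑ n ∈ Ioc 0 N, primeLog ω n) / (N : ℝ)) atTop (𝓝 α))
    (hF : ∀ᶠ u in atTop, Summable fun n : ℕ => ω n / n * exp (-(log n / u))) :
    Tendsto (fun N : ℕ => (∑' n : ℕ, ω n / n * exp (-(log n / log N))) /
      ∏ p ∈ (N + 1).primesBelow, eulerFactor ω 0 p) atTop
      (𝓝 (exp (-(eulerMascheroniConstant * α)))) := by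
  obtain ⟨hsum, hlim⟩ := tendsto_tsum_sub_expSum (d := fun n => primeLog ω n / n)
    (fun n => div_nonneg (primeLog_nonneg hnn n) (Nat.cast_nonneg n)) (by simp)
    (by simp [primeLog]) (tendsto_expSum_div_div hg)
  have hlog : Tendsto (fun N : ℕ => log (N : ℝ)) atTop atTop :=
    tendsto_log_atTop.comp tendsto_natCast_atTop_atTop
  have hrem := ((tendsto_tsum_logRemainder hnn hω1 hγ₁ hγ₂0 hγ₂2 hpp).comp hlog).sub
    ((tendsto_add_atTop_iff_nat 1).2
      (summable_logRemainder hnn hω1 hγ₁ hγ₂0 hγ₂2 hpp le_rfl).hasSum.tendsto_sum_nat)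
  have h := ((hlim.comp hlog).add hrem).rexp
  rw [sub_self, add_zero] at h
  refine h.congr' ?_
  filter_upwards [hlog.eventually hF, hlog.eventually (eventually_gt_atTop 0),
    eventually_gt_atTop 0] with N hFN hN hN0
  have hcomm : ∀ n : ℕ, log n / log N = (log N)⁻¹ * log n := fun n => by
    rw [div_eq_inv_mul]
  have hG := hsum _ hN
  simp only [Function.comp_apply]
  simp only [hcomm] at hFN hG ⊢
  obtain ⟨hpos, he⟩ := log_tsum_eq hnn hω1 hmult hγ₁ hγ₂0 hγ₂2 hpp (inv_nonneg.2 hN.le) hFN hG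
  have hP : 0 < ∏ p ∈ (N + 1).primesBelow, eulerFactor ω 0 p := Finset.prod_pos fun p hp =>
    zero_lt_one.trans_le (one_le_eulerFactor hnn hω1 hγ₁ hγ₂0 hγ₂2 hpp le_rfl
      (Nat.prime_of_mem_primesBelow hp))
  have hS : ∑ n ∈ range (N + 1), primeLog ω n / n / log n * exp (-(0 * log n)) =
      expSum (fun n => primeLog ω n / n / log n) (log N) := by
    simp only [zero_mul, neg_zero, exp_zero, mul_one]
    rw [expSum_log hN0]
    refine (Finset.sum_subset (fun n hn => ?_) fun n _ hn => ?_).symm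
    · exact Finset.mem_range.2 (Nat.lt_succ_of_le (Finset.mem_Ioc.1 hn).2)
    · have : n = 0 := by
        simp only [Finset.mem_Ioc, Finset.mem_range] at *
        omega
      simp [this]
  rw [← exp_log (div_pos hpos hP), log_div hpos.ne' hP.ne', he,
    log_prod_eulerFactor hnn hω1 hγ₁ hγ₂0 hγ₂2 hpp le_rfl, hS]
  congr 1
  ring

lemma tendsto_sum_mul_log_div (hnn : ∀ n, 0 ≤ ω n) (hω1 : ω 1 = 1)
    (hmult : ∀ m n : ℕ, Nat.Coprime m n → ω (m * n) = ω m * ω n) (hα : 0 < α) (hγ₁ : 0 < γ₁)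
    (hγ₂0 : 0 < γ₂) (hγ₂2 : γ₂ < 2)
    (hpp : ∀ p k : ℕ, Nat.Prime p → 1 ≤ k → ω (p ^ k) ≤ γ₁ * γ₂ ^ k)
    (hg : Tendsto (fun N : ℕ => (∑ n ∈ Ioc 0 N, primeLog ω n) / (N : ℝ)) atTop (𝓝 α)) :
    Tendsto (fun N : ℕ => log N * (∑ n ∈ Ioc 0 N, ω n) /
      (N * ∏ p ∈ (N + 1).primesBelow, eulerFactor ω 0 p)) atTop
      (𝓝 (exp (-(eulerMascheroniConstant * α)) / Gamma α)) := by
  have hs := summable_correction_div hnn hγ₁ hγ₂0 hγ₂2 hpp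
  have hc : ∀ n : ℕ, 0 ≤ ω n / n := fun n => div_nonneg (hnn n) (Nat.cast_nonneg n)
  have hc1 : 0 < ω 1 / ((1 : ℕ) : ℝ) := by simp [hω1]
  obtain ⟨hF, hlap⟩ := (eulerRelation_div hnn hmult hg hs).laplace (by linarith) hc (by simp) hc1
  have hlog : Tendsto (fun N : ℕ => log (N : ℝ)) atTop atTop :=
    tendsto_log_atTop.comp tendsto_natCast_atTop_atTop
  have hGα : Gamma α ≠ 0 := (Gamma_pos_of_pos hα).ne'
  have hGα1 : Gamma (α + 1) ≠ 0 := (Gamma_pos_of_pos (by linarith)).ne'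
  have h := (((tendsto_mul_expSum_div hnn hω1 hmult hg hs).comp hlog).mul
    (tendsto_tsum_div_prod_eulerFactor hnn hω1 hmult hγ₁ hγ₂0 hγ₂2 hpp hg hF)).div
    (hlap.comp hlog) hGα1
  have hval : α * exp (-(eulerMascheroniConstant * α)) / Gamma (α + 1) =
      exp (-(eulerMascheroniConstant * α)) / Gamma α := by
    rw [Gamma_add_one hα.ne', mul_div_mul_left _ _ hα.ne']
  rw [hval] at h
  refine h.congr' ?_
  filter_upwards [hlog.eventually hF, hlog.eventually (eventually_gt_atTop 0),
    eventually_gt_atTop 0] with N hFN hN hN0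
  have hN' : (0 : ℝ) < N := by exact_mod_cast hN0
  have hM : expSum (fun n => ω n / n) (log N) ≠ 0 := (expSum_pos hc hc1 hN.le).ne'
  have hT : ∑' n : ℕ, ω n / n * exp (-(log n / log N)) ≠ 0 :=
    (hFN.tsum_pos (fun n => mul_nonneg (hc n) (exp_pos _).le) 1 (by simp [hω1])).ne'
  have hP : ∏ p ∈ (N + 1).primesBelow, eulerFactor ω 0 p ≠ 0 := Finset.prod_ne_zero_iff.2
    fun p hp => (zero_lt_one.trans_le (one_le_eulerFactor hnn hω1 hγ₁ hγ₂0 hγ₂2 hpp le_rfl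
      (Nat.prime_of_mem_primesBelow hp))).ne'
  simp only [Function.comp_apply, Pi.div_apply, exp_log hN', expSum_log hN0] at hM ⊢
  generalize ∑' n : ℕ, ω n / n * exp (-(log n / log N)) = F at hT ⊢
  field_simp

end MeanValue

end Wirsing


/-- Wirsing's theorem on mean values of nonnegative multiplicative functions. -/
theorem stmt_11 (ω : ℕ → ℝ) (hnn : ∀ n, 0 ≤ ω n) (hω1 : ω 1 = 1)
    (hmult : ∀ m n : ℕ, Nat.Coprime m n → ω (m * n) = ω m * ω n)
    (α : ℝ) (hα : 0 < α)
    (hprime : Tendsto (fun N : ℕ =>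
        (∑ p ∈ Finset.filter Nat.Prime (Finset.range (N + 1)), ω p * Real.log p) / (N : ℝ))
      atTop (nhds α))
    (γ₁ γ₂ : ℝ) (hγ₁ : 0 < γ₁) (hγ₂0 : 0 < γ₂) (hγ₂2 : γ₂ < 2)
    (hpp : ∀ p k : ℕ, Nat.Prime p → 1 ≤ k → ω (p ^ k) ≤ γ₁ * γ₂ ^ k) :
    ∃ E : ℕ → ℝ, Tendsto E atTop (nhds 0) ∧
      ∀ N : ℕ, 2 ≤ N → ∑ n ∈ Finset.Icc 1 N, ω n =
        (1 + E N) * (Real.exp (-(Real.eulerMascheroniConstant * α)) / Real.Gamma α) *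
          ((N : ℝ) / Real.log N) *
          ∏ p ∈ Finset.filter Nat.Prime (Finset.range (N + 1)),
            ∑' k : ℕ, ω (p ^ k) / (p : ℝ) ^ k := by
  simp only [← Wirsing.sum_primeLog_eq] at hprime
  have hlim := Wirsing.tendsto_sum_mul_log_div hnn hω1 hmult hα hγ₁ hγ₂0 hγ₂2 hpp hprime
  set κ := Real.exp (-(Real.eulerMascheroniConstant * α)) / Real.Gamma α
  have hκ : κ ≠ 0 := (div_pos (Real.exp_pos _) (Real.Gamma_pos_of_pos hα)).ne'
  have hfactor : ∀ p : ℕ, ∑' k : ℕ, ω (p ^ k) / (p : ℝ) ^ k = Wirsing.eulerFactor ω 0 p :=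
    fun p => by simp [Wirsing.eulerFactor]
  have hE := (hlim.div_const κ).sub_const 1
  rw [div_self hκ, sub_self] at hE
  refine ⟨_, hE, fun N hN => ?_⟩
  have hN0 : (N : ℝ) ≠ 0 := by exact_mod_cast (by omega : N ≠ 0)
  have hlog : Real.log N ≠ 0 := (Real.log_pos (by exact_mod_cast hN)).ne'
  have hP : ∏ p ∈ (N + 1).primesBelow, Wirsing.eulerFactor ω 0 p ≠ 0 :=
    Finset.prod_ne_zero_iff.2 fun p hp => (zero_lt_one.trans_le
      (Wirsing.one_le_eulerFactor hnn hω1 hγ₁ hγ₂0 hγ₂2 hpp le_rfl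
        (Nat.prime_of_mem_primesBelow hp))).ne'
  simp only [hfactor]
  change ∑ n ∈ Finset.Ioc 0 N, ω n = _ * ∏ p ∈ (N + 1).primesBelow, _
  field_simp
  ring
end
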